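/- The family of languages accepted by reversible deterministic two-party Watson-Crick systems is not closed under intersection with regular languages. -/

import Mathlib

namespace WK

/-- Tape symbols: input symbols plus the two endmarkers.
`Sum.inr false` is the left endmarker, `Sum.inr true` the right endmarker. -/
abbrev TSym (α : Type) : Type := α ⊕ Bool

/-- The tape for input `w`: left endmarker, the symbols of `w`, right endmarker. -/
def tape {α : Type} (w : List α) (k : ℕ) : TSym α :=
  ((Sum.inr false :: w.map Sum.inl) ++ [Sum.inr true]).getD k (Sum.inr true)

/-- A deterministic two-party Watson-Crick system: two finite automata (the upper
component `1` and the lower component `2`) with a finite set `M` of messages,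
partial transition functions `δᵢ` (depending on state, scanned symbol and received
message, `none` = no message) and broadcast functions `μᵢ`. -/
structure DPWK (α : Type) where
  M : Type
  Q1 : Type
  Q2 : Type
  fM : Fintype M
  fQ1 : Fintype Q1
  fQ2 : Fintype Q2
  δ1 : Q1 → TSym α → Option M → Option (Q1 × Bool)
  δ2 : Q2 → TSym α → Option M → Option (Q2 × Bool)
  μ1 : Q1 → TSym α → Option M
  μ2 : Q2 → TSym α → Option M
  q01 : Q1
  q02 : Q2
  F1 : Set Q1
  F2 : Set Q2

/-- A configuration: states and head positions of the two components. -/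
structure Config {α : Type} (A : DPWK α) where
  p : A.Q1
  i : ℕ
  q : A.Q2
  j : ℕ

/-- One synchronous (forward) computation step: each component reads its symbol,
receives the message broadcast by the other component, changes its state and
optionally moves (the upper head to the right, the lower head to the left). -/
def Step {α : Type} (A : DPWK α) (w : List α) (c c' : Config A) : Prop :=
  ∃ d1 d2 : Bool,
    A.δ1 c.p (tape w c.i) (A.μ2 c.q (tape w c.j)) = some (c'.p, d1) ∧
    A.δ2 c.q (tape w c.j) (A.μ1 c.p (tape w c.i)) = some (c'.q, d2) ∧
    c'.i = c.i + (cond d1 1 0) ∧ c.j = c'.j + (cond d2 1 0)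

/-- The initial configuration on input `w`: the upper component on the left
endmarker, the lower component on the right endmarker. -/
def initConf {α : Type} (A : DPWK α) (w : List α) : Config A :=
  ⟨A.q01, 0, A.q02, w.length + 1⟩

/-- The system halts in `c` if no successor configuration exists. -/
def Halted {α : Type} (A : DPWK α) (w : List α) (c : Config A) : Prop :=
  ¬ ∃ c', Step A w c c'

/-- A configuration is accepting if at least one component is in an accepting state. -/
def AccConf {α : Type} (A : DPWK α) (c : Config A) : Prop :=
  c.p ∈ A.F1 ∨ c.q ∈ A.F2

/-- `cs` is an accepting computation of `A` on `w`: it starts in the initial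
configuration, follows the step relation, and ends in a halting configuration
with at least one component in an accepting state. -/
def AccComp {α : Type} (A : DPWK α) (w : List α) (cs : List (Config A)) : Prop :=
  cs.head? = some (initConf A w) ∧ List.Chain' (Step A w) cs ∧
    ∃ c, cs.getLast? = some c ∧ Halted A w c ∧ AccConf A c

def Accepts {α : Type} (A : DPWK α) (w : List α) : Prop := ∃ cs, AccComp A w cs

/-- The language accepted by `A`. -/
def lang {α : Type} (A : DPWK α) : Set (List α) := { w | Accepts A w }

/-- One backward computation step, induced by reverse transition functions `δ'ᵢ` and
reverse broadcast functions `μ'ᵢ`: the heads first move to their predecessor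
positions (the upper head left, the lower head right) and then read the symbols there. -/
def BackStep {α : Type} (A : DPWK α)
    (δ'1 : A.Q1 → TSym α → Option A.M → Option (A.Q1 × Bool))
    (δ'2 : A.Q2 → TSym α → Option A.M → Option (A.Q2 × Bool))
    (μ'1 : A.Q1 → TSym α → Option A.M)
    (μ'2 : A.Q2 → TSym α → Option A.M)
    (w : List α) (c' c : Config A) : Prop :=
  ∃ d1 d2 : Bool,
    δ'1 c'.p (tape w c.i) (μ'2 c'.q (tape w c.j)) = some (c.p, d1) ∧
    δ'2 c'.q (tape w c.j) (μ'1 c'.p (tape w c.i)) = some (c.q, d2) ∧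
    c'.i = c.i + (cond d1 1 0) ∧ c.j = c'.j + (cond d2 1 0)

/-- A witness of reversibility: reverse transition and broadcast functions whose
induced backward step relation is exactly the inverse of the forward step relation,
so every configuration has at most one predecessor, computable by such a system. -/
structure RevWitness {α : Type} (A : DPWK α) where
  δ'1 : A.Q1 → TSym α → Option A.M → Option (A.Q1 × Bool)
  δ'2 : A.Q2 → TSym α → Option A.M → Option (A.Q2 × Bool)
  μ'1 : A.Q1 → TSym α → Option A.M
  μ'2 : A.Q2 → TSym α → Option A.M
  inverse : ∀ (w : List α) (c c' : Config A),
    BackStep A δ'1 δ'2 μ'1 μ'2 w c' c ↔ Step A w c c'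

/-- A reversible deterministic two-party Watson-Crick system (REV-PWK). -/
def Reversible {α : Type} (A : DPWK α) : Prop := Nonempty (RevWitness A)

/-- Number of messages (`0`, `1` or `2`) broadcast in one step from configuration `c`,
with respect to broadcast functions `μ1`, `μ2`. -/
def stepMsgs {α : Type} (A : DPWK α)
    (μ1 : A.Q1 → TSym α → Option A.M) (μ2 : A.Q2 → TSym α → Option A.M)
    (w : List α) (c : Config A) : ℕ :=
  ((μ1 c.p (tape w c.i)).elim 0 fun _ => 1) + ((μ2 c.q (tape w c.j)).elim 0 fun _ => 1)

/-- Total number of messages sent during the computation `cs` (no messages are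
sent from the final, halting configuration). -/
def commCount {α : Type} (A : DPWK α)
    (μ1 : A.Q1 → TSym α → Option A.M) (μ2 : A.Q2 → TSym α → Option A.M)
    (w : List α) (cs : List (Config A)) : ℕ :=
  (cs.dropLast.map (stepMsgs A μ1 μ2 w)).sum

/-- `A` is a reversible system that is communication bounded by `f`: it is reversible
and every word of its language is accepted by a computation in which the number of
messages sent in the forward computation and in the reverse computation are each at
most `f` of the input length. -/
def RevCommBounded {α : Type} (A : DPWK α) (f : ℕ → ℕ) : Prop :=
  ∃ Wit : RevWitness A, ∀ w ∈ lang A, ∃ cs, AccComp A w cs ∧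
    commCount A A.μ1 A.μ2 w cs ≤ f w.length ∧
    commCount A Wit.μ'1 Wit.μ'2 w cs.reverse ≤ f w.length

/-- `A` (not necessarily reversible) is communication bounded by `f`. -/
def CommBounded {α : Type} (A : DPWK α) (f : ℕ → ℕ) : Prop :=
  ∀ w ∈ lang A, ∃ cs, AccComp A w cs ∧ commCount A A.μ1 A.μ2 w cs ≤ f w.length

/-- The family of languages accepted by reversible deterministic two-party
Watson-Crick systems over the alphabet `α`. -/
def RevPWKLangs (α : Type) : Set (Set (List α)) :=
  { L | ∃ A : DPWK α, Reversible A ∧ lang A = L }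

/-- Languages accepted by REV-PWKs with `O(f)` communication. -/
def RevPWKLangsO (α : Type) (f : ℕ → ℕ) : Set (Set (List α)) :=
  { L | ∃ (A : DPWK α) (C : ℕ),
      RevCommBounded A (fun n => C * f n + C) ∧ lang A = L }

/-- Languages accepted by (possibly irreversible) DPWKs with `O(f)` communication. -/
def PWKLangsO (α : Type) (f : ℕ → ℕ) : Set (Set (List α)) :=
  { L | ∃ (A : DPWK α) (C : ℕ),
      CommBounded A (fun n => C * f n + C) ∧ lang A = L }

end WK

open Relation
namespace PWKaux

/-- Abstract configurations of a two-head system on a bi-infinite tape. -/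
@[ext] structure Cfg (S : Type) where
  s : S
  u : ℤ
  l : ℤ

abbrev Sys (S A : Type) := S → A → A → Option (S × Bool × Bool)

def Stp {S A : Type} (F : Sys S A) (T : ℤ → A) (c d : Cfg S) : Prop :=
  ∃ d1 d2 : Bool, F c.s (T c.u) (T c.l) = some (d.s, d1, d2) ∧
    d.u = c.u + (d1.toNat : ℤ) ∧ d.l = c.l - (d2.toNat : ℤ)

abbrev Reach {S A : Type} (F : Sys S A) (T : ℤ → A) : Cfg S → Cfg S → Prop :=
  ReflTransGen (Stp F T)

def Inj {S A : Type} (F : Sys S A) : Prop :=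
  ∀ s r x y t d1 d2 e1 e2, F s x y = some (t, d1, d2) → F r x y = some (t, e1, e2) → s = r

section basic
variable {S A : Type} {F : Sys S A} {T : ℤ → A}

lemma Stp.det {c d e : Cfg S} (h : Stp F T c d) (h' : Stp F T c e) : d = e := by
  obtain ⟨d1, d2, h1, h2, h3⟩ := h
  obtain ⟨e1, e2, g1, g2, g3⟩ := h'
  rw [h1] at g1
  simp only [Option.some.injEq, Prod.mk.injEq] at g1
  obtain ⟨a, b, c⟩ := g1
  subst b c
  ext <;> simp_all

lemma Stp.mono {c d : Cfg S} (h : Stp F T c d) :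
    c.u ≤ d.u ∧ d.u ≤ c.u + 1 ∧ d.l ≤ c.l ∧ c.l ≤ d.l + 1 := by
  obtain ⟨d1, d2, h1, h2, h3⟩ := h
  cases d1 <;> cases d2 <;> simp at h2 h3 <;> omega

lemma Reach.mono {c d : Cfg S} (h : Reach F T c d) : c.u ≤ d.u ∧ d.l ≤ c.l := by
  induction h with
  | refl => simp
  | tail _ h ih => have := h.mono; omega

lemma Reach.total {c a b : Cfg S} (h : Reach F T c a) (h' : Reach F T c b) :
    Reach F T a b ∨ Reach F T b a :=
  ReflTransGen.total_of_right_unique (fun _ _ _ h h' => h.det h') h h'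

/-- ordering along a deterministic run, by upper position -/
lemma Reach.ord_step {i a c d : Cfg S} (ha : Reach F T i a) (hc : Reach F T i c)
    (hs : Stp F T c d) (hlt : a.u < d.u) : Reach F T a c := by
  rcases Reach.total ha hc with h | h
  · exact h
  · rcases h.cases_head with h | ⟨x, hx, h⟩
    · subst h; exact .refl
    · have := hs.det hx; subst this
      have := Reach.mono h; omega

lemma Reach.ord_u {i a b : Cfg S} (ha : Reach F T i a) (hb : Reach F T i b)
    (hlt : a.u < b.u) : Reach F T a b := by
  rcases Reach.total ha hb with h | h
  · exact h
  · have := Reach.mono h; omega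

lemma Reach.ord_l {i a b : Cfg S} (ha : Reach F T i a) (hb : Reach F T i b)
    (hlt : b.l < a.l) : Reach F T a b := by
  rcases Reach.total ha hb with h | h
  · exact h
  · have := Reach.mono h; omega

lemma Reach.arrive {i f : Cfg S} (h : Reach F T i f) (x : ℤ) (h1 : i.u < x) (h2 : x ≤ f.u) :
    ∃ c d, Reach F T i c ∧ Stp F T c d ∧ Reach F T d f ∧ c.u = x - 1 ∧ d.u = x := by
  induction h with
  | refl => omega
  | @tail b c hb hs ih =>
    by_cases hx : x ≤ b.u
    · obtain ⟨c', d', p1, p2, p3, p4⟩ := ih hx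
      exact ⟨c', d', p1, p2, p3.tail hs, p4⟩
    · have := hs.mono
      exact ⟨b, c, hb, hs, .refl, by omega, by omega⟩

/-- every lower position between the two ends of a run is visited -/
lemma Reach.visit {c d : Cfg S} (h : Reach F T c d) (Φ : ℤ → Prop)
    (hΦ : ∀ e, Reach F T c e → Reach F T e d → Φ e.l) : ∀ z, d.l ≤ z → z ≤ c.l → Φ z := by
  induction h with
  | refl =>
    intro z h1 h2
    have : z = c.l := by omega
    subst this; exact hΦ c .refl .refl
  | @tail b d hb hs ih =>
    intro z h1 h2
    have := hs.mono
    by_cases hz : z = d.l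
    · subst hz; exact hΦ d (hb.tail hs) .refl
    · exact ih (fun e h1 h2 => hΦ e h1 (h2.tail hs)) z (by omega) h2

lemma Reach.const {c d : Cfg S} (h : Reach F T c d)
    (hq : ∀ e f, Reach F T c e → Stp F T e f → Reach F T f d → T e.l = T f.l) :
    ∀ e, Reach F T c e → Reach F T e d → T e.l = T c.l := by
  intro e h1
  induction h1 with
  | refl => intro _; rfl
  | @tail b e hb hs ih =>
    intro h2
    rw [← hq b e hb hs h2]
    exact ih (.head hs h2)

/-- Mirror image. -/
def mF (F : Sys S A) : Sys S A := fun s x y => (F s y x).map fun z => (z.1, z.2.2, z.2.1)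
def mT (T : ℤ → A) : ℤ → A := fun k => T (-k)
def mc (c : Cfg S) : Cfg S := ⟨c.s, -c.l, -c.u⟩

@[simp] lemma mF_mF (F : Sys S A) : mF (mF F) = F := by
  funext s x y
  simp only [mF, Option.map_map]
  cases F s x y <;> rfl
@[simp] lemma mT_mT (T : ℤ → A) : mT (mT T) = T := by funext k; simp [mT]
@[simp] lemma mc_mc (c : Cfg S) : mc (mc c) = c := by ext <;> simp [mc]
@[simp] lemma mc_s (c : Cfg S) : (mc c).s = c.s := rfl
@[simp] lemma mc_u (c : Cfg S) : (mc c).u = -c.l := rfl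
@[simp] lemma mc_l (c : Cfg S) : (mc c).l = -c.u := rfl

lemma Inj.mirror (h : Inj F) : Inj (mF F) := by
  intro s r x y t d1 d2 e1 e2 h1 h2
  simp only [mF, Option.map_eq_some_iff, Prod.exists, Prod.mk.injEq] at h1 h2
  obtain ⟨a, b, c, h1, rfl, rfl, rfl⟩ := h1
  obtain ⟨a', b', c', h2, rfl, rfl, rfl⟩ := h2
  exact h _ _ _ _ _ _ _ _ _ h1 h2

lemma Stp.mirror {c d : Cfg S} (h : Stp F T c d) : Stp (mF F) (mT T) (mc c) (mc d) := by
  obtain ⟨d1, d2, h1, h2, h3⟩ := h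
  refine ⟨d2, d1, ?_, ?_, ?_⟩
  · simp [mF, mT, h1]
  · simp [h3]; ring
  · simp [h2]; ring

lemma Stp.mirror' {c d : Cfg S} (h : Stp (mF F) (mT T) c d) : Stp F T (mc c) (mc d) := by
  simpa using h.mirror

lemma Reach.mirror {c d : Cfg S} (h : Reach F T c d) : Reach (mF F) (mT T) (mc c) (mc d) := by
  induction h with
  | refl => exact .refl
  | tail _ h ih => exact ih.tail h.mirror

lemma Reach.mirror' {c d : Cfg S} (h : Reach (mF F) (mT T) c d) : Reach F T (mc c) (mc d) := by
  simpa using Reach.mirror h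

/-- The tape contains the word `u` starting at position `p`. -/
def Rd (T : ℤ → A) : ℤ → List A → Prop
  | _, [] => True
  | p, x :: u => T p = x ∧ Rd T (p + 1) u

lemma Rd_append {p : ℤ} {u v : List A} :
    Rd T p (u ++ v) ↔ Rd T p u ∧ Rd T (p + u.length) v := by
  induction u generalizing p with
  | nil => simp [Rd]
  | cons x u ih =>
    simp only [List.cons_append, Rd, ih, List.length_cons, Nat.cast_add, Nat.cast_one]
    rw [show p + 1 + (u.length : ℤ) = p + (u.length + 1) by ring]
    tauto

lemma Rd_replicate {p : ℤ} {n : ℕ} {x : A} :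
    Rd T p (List.replicate n x) ↔ ∀ k : ℕ, k < n → T (p + k) = x := by
  induction n generalizing p with
  | zero => simp [Rd]
  | succ n ih =>
    rw [List.replicate_succ, Rd, ih]
    constructor
    · rintro ⟨h0, h⟩ k hk
      rcases k with _ | k
      · simpa using h0
      · have := h k (by omega)
        rw [← this]; push_cast; ring_nf
    · intro h
      refine ⟨by simpa using h 0 (by omega), fun k hk => ?_⟩
      have := h (k+1) (by omega)
      rw [← this]; push_cast; ring_nf

lemma Rd_iff {p : ℤ} {u : List A} :
    Rd T p u ↔ ∀ k : ℕ, ∀ x, u[k]? = some x → T (p + k) = x := by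
  induction u generalizing p with
  | nil => simp [Rd]
  | cons y u ih =>
    rw [Rd, ih]
    constructor
    · rintro ⟨h0, h⟩ k x hk
      rcases k with _ | k
      · simp at hk; subst hk; simpa using h0
      · have := h k x (by simpa using hk)
        rw [← this]; push_cast; ring_nf
    · intro h
      refine ⟨by simpa using h 0 y (by simp), fun k x hk => ?_⟩
      have := h (k+1) x (by simpa using hk)
      rw [← this]; push_cast; ring_nf

lemma Rd_congr {T' : ℤ → A} {p : ℤ} {u : List A} (h : Rd T p u)
    (hc : ∀ z, p ≤ z → z < p + u.length → T' z = T z) : Rd T' p u := by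
  rw [Rd_iff] at *
  intro k x hk
  rw [hc]
  · exact h k x hk
  · omega
  · have := (List.getElem?_eq_some_iff.1 hk).1
    omega

lemma Rd_mirror {p : ℤ} {u : List A} (h : Rd T p u) :
    Rd (mT T) (-(p + u.length - 1)) u.reverse := by
  induction u generalizing p with
  | nil => simp [Rd]
  | cons x u ih =>
    rw [List.reverse_cons, Rd_append]
    obtain ⟨h0, h⟩ := h
    have := ih h
    constructor
    · convert this using 1; simp; ring
    · simp only [Rd, mT, and_true, List.length_reverse, List.length_cons]
      rw [← h0]; congr 1; push_cast; ring

end basic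

/-- The upper head crosses the word `u`, with the lower head reading only `y`; the lower head
moves `δ` cells meanwhile. -/
inductive UP {S A : Type} (F : Sys S A) (y : A) : List A → S → S → ℕ → Prop
  | nil (s : S) : UP F y [] s s 0
  | stay {x : A} {u : List A} {s s1 s' : S} {d : Bool} {δ : ℕ} :
      F s x y = some (s1, false, d) → UP F y (x :: u) s1 s' δ → UP F y (x :: u) s s' (d.toNat + δ)
  | move {x : A} {u : List A} {s s1 s' : S} {d : Bool} {δ : ℕ} :
      F s x y = some (s1, true, d) → UP F y u s1 s' δ → UP F y (x :: u) s s' (d.toNat + δ)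

section up
variable {S A : Type} {F : Sys S A} {T : ℤ → A} {y : A}

lemma UP.append {u v : List A} {s s1 s2 : S} {a b : ℕ} (h : UP F y u s s1 a)
    (h' : UP F y v s1 s2 b) : UP F y (u ++ v) s s2 (a + b) := by
  induction h with
  | nil => simpa using h'
  | stay e _ ih => rw [add_assoc]; exact .stay e (ih h')
  | move e _ ih => rw [add_assoc]; exact .move e (ih h')

lemma UP.split {u v : List A} {s s2 : S} {c : ℕ} (h : UP F y (u ++ v) s s2 c) :
    ∃ s1 a b, UP F y u s s1 a ∧ UP F y v s1 s2 b ∧ c = a + b := by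
  generalize hw : u ++ v = w at h
  induction h generalizing u with
  | nil s =>
    simp at hw; obtain ⟨rfl, rfl⟩ := hw
    exact ⟨s, 0, 0, .nil _, .nil _, rfl⟩
  | @stay x w' s s1 s' d δ e h ih =>
    rcases u with _ | ⟨x', u⟩
    · simp at hw; subst hw
      exact ⟨s, 0, _, .nil _, .stay e h, by simp⟩
    · have hw' := hw
      simp at hw; obtain ⟨rfl, rfl⟩ := hw
      obtain ⟨t, a, b, h1, h2, h3⟩ := ih hw'
      exact ⟨t, _, b, .stay e h1, h2, by omega⟩
  | @move x w' s s1 s' d δ e h ih =>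
    rcases u with _ | ⟨x', u⟩
    · simp at hw; subst hw
      exact ⟨s, 0, _, .nil _, .move e h, by simp⟩
    · simp at hw; obtain ⟨rfl, hw⟩ := hw
      obtain ⟨t, a, b, h1, h2, h3⟩ := ih hw
      exact ⟨t, _, b, .move e h1, h2, by omega⟩

lemma UP.det {u : List A} {s s1 s2 : S} {a b : ℕ} (h : UP F y u s s1 a)
    (h' : UP F y u s s2 b) : s1 = s2 ∧ a = b := by
  induction h generalizing b with
  | nil s => cases h'; simp
  | stay e _ ih =>
    cases h' with
    | stay e' h' =>
      rw [e] at e'; simp at e'; obtain ⟨rfl, rfl⟩ := e'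
      have := ih h'; simp [this]
    | move e' h' => rw [e] at e'; simp at e'
  | move e _ ih =>
    cases h' with
    | stay e' h' => rw [e] at e'; simp at e'
    | move e' h' =>
      rw [e] at e'; simp at e'; obtain ⟨rfl, rfl⟩ := e'
      have := ih h'; simp [this]

lemma UP.realize {u : List A} {s s' : S} {δ : ℕ} (h : UP F y u s s' δ) (p q : ℤ)
    (hu : Rd T p u) (hl : ∀ k : ℕ, k ≤ δ → T (q - k) = y) :
    Reach F T ⟨s, p, q⟩ ⟨s', p + u.length, q - δ⟩ := by
  induction h generalizing p q with
  | nil => simp; exact .refl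
  | @stay x u s s1 s' d δ e _ ih =>
    have h0 := hl 0 (by omega)
    simp at h0
    refine .head (b := ⟨s1, p, q - (d.toNat : ℤ)⟩) ⟨false, d, ?_, ?_, ?_⟩ ?_
    · simp [hu.1, h0, e]
    · simp
    · simp
    · have := ih p (q - (d.toNat : ℤ)) hu (fun k hk => by
        have := hl (d.toNat + k) (by omega)
        rw [← this]; push_cast; ring_nf)
      convert this using 2; push_cast; ring
  | @move x u s s1 s' d δ e _ ih =>
    have h0 := hl 0 (by omega)
    simp at h0
    refine .head (b := ⟨s1, p + 1, q - (d.toNat : ℤ)⟩) ⟨true, d, ?_, ?_, ?_⟩ ?_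
    · simp [hu.1, h0, e]
    · simp
    · simp
    · have := ih (p + 1) (q - (d.toNat : ℤ)) hu.2 (fun k hk => by
        have := hl (d.toNat + k) (by omega)
        rw [← this]; push_cast; ring_nf)
      convert this using 2
      · push_cast [List.length_cons]; ring
      · push_cast; ring

lemma UP.extract {c c0 d : Cfg S} (h : Reach F T c c0) (hs : Stp F T c0 d)
    (hd : d.u = c0.u + 1) : ∀ u : List A, d.u = c.u + u.length → Rd T c.u u →
    (∀ e, Reach F T c e → Reach F T e c0 → T e.l = y) →
    ∃ δ : ℕ, UP F y u c.s d.s δ ∧ c.l - d.l = δ := by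
  induction h using ReflTransGen.head_induction_on with
  | refl =>
    intro u hu hr hy
    obtain ⟨d1, d2, h1, h2, h3⟩ := hs
    have hl : u.length = 1 := by omega
    obtain ⟨x, rfl⟩ := List.length_eq_one_iff.1 hl
    have : d1 = true := by
      cases d1 <;> simp at h2 <;> [omega; rfl]
    subst this
    rw [hr.1, hy c0 .refl .refl] at h1
    exact ⟨_, .move h1 (.nil _), by simp [h3]⟩
  | @head c c1 hc hr ih =>
    intro u hu hrd hy
    have hm := Reach.mono hr
    have hm' := hc.mono
    obtain ⟨d1, d2, h1, h2, h3⟩ := hc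
    rcases u with _ | ⟨x, u⟩
    · simp at hu; omega
    have hy0 := hy c .refl (.head ⟨d1, d2, h1, h2, h3⟩ hr)
    have hy' : ∀ e, Reach F T c1 e → Reach F T e c0 → T e.l = y := fun e he he' =>
      hy e (.head ⟨d1, d2, h1, h2, h3⟩ he) he'
    rw [hrd.1, hy0] at h1
    cases d1
    · simp at h2
      obtain ⟨δ, g1, g2⟩ := ih (x :: u) (by rw [h2]; exact hu) (by rw [h2]; exact hrd) hy'
      exact ⟨_, .stay h1 g1, by push_cast; omega⟩
    · simp at h2
      obtain ⟨δ, g1, g2⟩ := ih u (by simp at hu; omega) (by rw [h2]; exact hrd.2) hy'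
      exact ⟨_, .move h1 g1, by push_cast; omega⟩

end up
end PWKaux

namespace PWKaux

section per
variable {S A : Type} {F : Sys S A} {x y : A}

/-- Orbit lemma. -/
lemma orbit [Fintype S] (n : ℕ) (f : ℕ → S) (hn : Fintype.card S ≤ n)
    (hinj : ∀ i j, i < n → j < n → f (i+1) = f (j+1) → f i = f j) :
    ∃ D, 1 ≤ D ∧ D ≤ Fintype.card S ∧ f D = f 0 := by
  classical
  obtain ⟨a, b, hab, he⟩ := Fintype.exists_ne_map_eq_of_card_lt
    (fun i : Fin (Fintype.card S + 1) => f i) (by simp)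
  wlog hlt : a < b generalizing a b
  · exact this b a hab.symm he.symm (lt_of_le_of_ne (not_lt.1 hlt) hab.symm)
  have key : ∀ i D : ℕ, i + D ≤ n → f (i + D) = f i → f D = f 0 := by
    intro i
    induction i with
    | zero => intro D _ h; simpa using h
    | succ i ih =>
      intro D h1 h2
      apply ih D (by omega)
      apply hinj _ _ (by omega) (by omega)
      rw [← h2]; congr 1; omega
  have ha := a.2
  have hb := b.2
  have hlt' : (a : ℕ) < b := hlt
  refine ⟨b - a, by omega, by omega, key a (b - a) (by omega) ?_⟩
  have he' : f a = f b := he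
  rw [he']; congr 1; omega

/-- state entered by an upper move while reading `x`, `y` -/
def Arrv (F : Sys S A) (x y : A) (s : S) : Prop := ∃ t d, F t x y = some (s, true, d)

def StR (F : Sys S A) (x y : A) (s t : S) : Prop := ∃ d, F s x y = some (t, false, d)

lemma UP.last {s z : S} {δ : ℕ} (h : UP F y [x] s z δ) :
    ∃ t d, ReflTransGen (StR F x y) s t ∧ F t x y = some (z, true, d) := by
  generalize hw : [x] = w at h
  induction h with
  | nil => simp at hw
  | stay e h ih =>
    obtain ⟨t, d, h1, h2⟩ := ih hw
    simp at hw; obtain ⟨rfl, rfl⟩ := hw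
    exact ⟨t, d, .head ⟨_, e⟩ h1, h2⟩
  | move e h ih =>
    simp at hw; obtain ⟨rfl, rfl⟩ := hw
    cases h
    exact ⟨_, _, .refl, e⟩

lemma inj1 (hI : Inj F) {s r z : S} {a b : ℕ} (h1 : UP F y [x] s z a) (h2 : UP F y [x] r z b)
    (hs : Arrv F x y s) (hr : Arrv F x y r) : s = r := by
  obtain ⟨t, d, p1, e1⟩ := h1.last
  obtain ⟨t', d', p2, e2⟩ := h2.last
  have := hI _ _ _ _ _ _ _ _ _ e1 e2
  subst this
  have key : ∀ s r : S, Arrv F x y r → ReflTransGen (StR F x y) s r → s = r := by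
    intro s r hr h
    rcases h.cases_tail with h | ⟨c, _, d, hc⟩
    · exact h.symm
    · obtain ⟨t, d', ht⟩ := hr
      have := hI _ _ _ _ _ _ _ _ _ ht hc
      subst this
      rw [ht] at hc; simp at hc
  rw [← reflTransGen_swap] at p1 p2
  rcases ReflTransGen.total_of_right_unique (by
    rintro a b c ⟨d, h⟩ ⟨d', h'⟩
    exact hI _ _ _ _ _ _ _ _ _ h h') p1 p2 with h | h
  · rw [reflTransGen_swap] at h
    exact (key _ _ hs h).symm
  · rw [reflTransGen_swap] at h
    exact key _ _ hr h

lemma UP.replicate_add {s s1 s2 : S} {m n a b : ℕ} (h : UP F y (List.replicate m x) s s1 a)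
    (h' : UP F y (List.replicate n x) s1 s2 b) : UP F y (List.replicate (m + n) x) s s2 (a + b) := by
  rw [List.replicate_add]; exact h.append h'

lemma UP.replicate_split {s s2 : S} {m n c : ℕ} (h : UP F y (List.replicate (m + n) x) s s2 c) :
    ∃ s1 a b, UP F y (List.replicate m x) s s1 a ∧ UP F y (List.replicate n x) s1 s2 b ∧
      c = a + b := by
  rw [List.replicate_add] at h; exact h.split

lemma UP.iter {e : S} {D κ : ℕ} (h : UP F y (List.replicate D x) e e κ) (m : ℕ) :
    UP F y (List.replicate (D * m) x) e e (κ * m) := by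
  induction m with
  | zero => exact .nil _
  | succ m ih => exact ih.replicate_add h

lemma per [Fintype S] (hI : Inj F) {e s' : S} {n δ : ℕ} (he : Arrv F x y e)
    (h : UP F y (List.replicate n x) e s' δ) (hn : Fintype.card S ≤ n) :
    ∃ D κ, 1 ≤ D ∧ D ≤ Fintype.card S ∧ UP F y (List.replicate D x) e e κ := by
  have hex : ∀ i, ∃ s, i ≤ n → ∃ a, UP F y (List.replicate i x) e s a := by
    intro i
    by_cases hi : i ≤ n
    · obtain ⟨k, rfl⟩ := Nat.exists_eq_add_of_le hi
      obtain ⟨s1, a, b, h1, _, _⟩ := h.replicate_split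
      exact ⟨s1, fun _ => ⟨a, h1⟩⟩
    · exact ⟨e, fun h => absurd h hi⟩
  choose f hf using hex
  have hstep : ∀ i, i < n → ∃ a, UP F y [x] (f i) (f (i+1)) a := by
    intro i hi
    obtain ⟨a, ha⟩ := hf (i+1) (by omega)
    obtain ⟨s1, a', b, h1, h2, _⟩ := ha.replicate_split
    obtain ⟨a'', h3⟩ := hf i (by omega)
    have := (h1.det h3).1
    subst this
    exact ⟨b, h2⟩
  have h0 : f 0 = e := by
    obtain ⟨a, ha⟩ := hf 0 (by omega)
    exact (ha.det (UP.nil e)).1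
  have harr : ∀ i, i ≤ n → Arrv F x y (f i) := by
    intro i hi
    rcases i with _ | i
    · rw [h0]; exact he
    · obtain ⟨a, ha⟩ := hstep i (by omega)
      obtain ⟨t, d, _, h⟩ := ha.last
      exact ⟨t, d, h⟩
  obtain ⟨D, h1, h2, h3⟩ := orbit n f hn (by
    intro i j hi hj hij
    obtain ⟨a, ha⟩ := hstep i hi
    obtain ⟨b, hb⟩ := hstep j hj
    rw [hij] at ha
    exact inj1 hI ha hb (harr i hi.le) (harr j hj.le))
  obtain ⟨κ, hκ⟩ := hf D (by omega)
  rw [h3, h0] at hκ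
  exact ⟨D, κ, h1, h2, hκ⟩

open Nat in
lemma per' [Fintype S] (hI : Inj F) {e s' : S} {n δ : ℕ} (he : Arrv F x y e)
    (h : UP F y (List.replicate n x) e s' δ) (hn : Fintype.card S ≤ n) :
    ∃ κ, UP F y (List.replicate (Fintype.card S)! x) e e κ := by
  obtain ⟨D, κ, h1, h2, h3⟩ := per hI he h hn
  obtain ⟨m, hm⟩ := Nat.dvd_factorial h1 h2
  rw [hm]
  exact ⟨_, h3.iter m⟩

open Nat in
/-- Changing the length of a long block by a multiple of the period. -/
lemma PER [Fintype S] (hI : Inj F) {s s' : S} {r r' δ : ℕ} (Q : ℕ)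
    (h : UP F y (List.replicate r x) s s' δ) (hr : Fintype.card S < r) (hr' : 1 ≤ r')
    (hm : r ≡ r' [MOD (Fintype.card S)! * Q]) :
    ∃ δ', UP F y (List.replicate r' x) s s' δ' ∧ δ ≡ δ' [MOD Q] := by
  obtain ⟨m, rfl⟩ : ∃ m, r = 1 + m := ⟨r - 1, by omega⟩
  obtain ⟨m', rfl⟩ : ∃ m', r' = 1 + m' := ⟨r' - 1, by omega⟩
  obtain ⟨e, a, b, h1, h2, rfl⟩ := h.replicate_split
  have he : Arrv F x y e := by
    obtain ⟨t, d, _, h⟩ := h1.last; exact ⟨t, d, h⟩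
  obtain ⟨κ, hκ⟩ := per' hI he h2 (by omega)
  have hκ := hκ.iter Q
  rcases le_total m m' with hle | hle
  · obtain ⟨t, ht⟩ := (Nat.modEq_iff_dvd' (by omega)).1 hm
    have hm' : m' = (Fintype.card S)! * Q * t + m := by omega
    rw [hm']
    refine ⟨_, h1.replicate_add ((hκ.iter t).replicate_add h2), ?_⟩
    apply Nat.ModEq.add_left
    rw [Nat.ModEq]
    simp [mul_comm, mul_left_comm]
  · obtain ⟨t, ht⟩ := (Nat.modEq_iff_dvd' (by omega)).1 hm.symm
    have hm' : m = (Fintype.card S)! * Q * t + m' := by omega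
    rw [hm'] at h2
    obtain ⟨e', a', b', g1, g2, rfl⟩ := h2.replicate_split
    obtain ⟨rfl, rfl⟩ := g1.det (hκ.iter t)
    refine ⟨_, h1.replicate_add g2, ?_⟩
    apply Nat.ModEq.add_left
    rw [Nat.ModEq]
    simp [mul_comm, mul_left_comm]

def HC (F : Sys S A) (C : ℕ) : Prop := ∀ y x s z δ, UP F y [x] s z δ → δ ≤ C

lemma exists_HC [Fintype S] [Fintype A] (F : Sys S A) : ∃ C, HC F C := by
  have : ∀ v : A × A × S, ∃ C, ∀ z δ, UP F v.1 [v.2.1] v.2.2 z δ → δ ≤ C := by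
    rintro ⟨y, x, s⟩
    by_cases h : ∃ z δ, UP F y [x] s z δ
    · obtain ⟨z, δ, h⟩ := h
      exact ⟨δ, fun z' δ' h' => (h.det h').2.ge⟩
    · exact ⟨0, fun z δ h' => absurd ⟨z, δ, h'⟩ h⟩
  choose f hf using this
  refine ⟨∑ v, f v, fun y x s z δ h => (hf (y, x, s) z δ h).trans ?_⟩
  exact Finset.single_le_sum (f := f) (fun _ _ => Nat.zero_le _) (Finset.mem_univ _)

lemma HC.le {C : ℕ} (hC : HC F C) {u : List A} : ∀ {s z : S} {δ : ℕ}, UP F y u s z δ →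
    δ ≤ C * u.length := by
  induction u with
  | nil => intro s z δ h; cases h; simp
  | cons x u ih =>
    intro s z δ h
    obtain ⟨s1, a, b, h1, h2, rfl⟩ := UP.split (u := [x]) h
    have := hC _ _ _ _ _ h1
    have := ih h2
    simp only [List.length_cons]
    nlinarith

def Stuck (F : Sys S A) (x y : A) (s : S) : Prop := ∀ z δ, ¬ UP F y [x] s z δ

lemma Stuck.drift {s s2 : S} {n δ : ℕ} (hs : Stuck F x y s)
    (h : UP (mF F) x (List.replicate n y) s s2 δ) : δ = 0 := by
  generalize hw : List.replicate n y = w at h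
  induction h generalizing n with
  | nil => rfl
  | @stay x' u s s1 s' d δ e h ih =>
    rcases n with _ | n
    · simp at hw
    have hw' := hw
    rw [List.replicate_succ] at hw
    simp at hw
    obtain ⟨rfl, rfl⟩ := hw
    simp only [mF, Option.map_eq_some_iff, Prod.exists, Prod.mk.injEq] at e
    obtain ⟨_, _, _, e, rfl, rfl, rfl⟩ := e
    rename_i d
    cases d
    · rw [ih (fun z δ h => hs _ _ (.stay e h)) hw']; rfl
    · exact absurd (UP.move e (.nil _)) (hs _ _)
  | @move x' u s s1 s' d δ e h ih =>
    rcases n with _ | n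
    · simp at hw
    rw [List.replicate_succ] at hw
    simp at hw
    obtain ⟨rfl, hw⟩ := hw
    simp only [mF, Option.map_eq_some_iff, Prod.exists, Prod.mk.injEq] at e
    obtain ⟨_, _, _, e, rfl, rfl, rfl⟩ := e
    rename_i d
    cases d
    · rw [ih (fun z δ h => hs _ _ (.stay e h)) hw]; rfl
    · exact absurd (UP.move e (.nil _)) (hs _ _)

lemma StuckPass {T : ℤ → A} {E c : Cfg S} (h : Reach F T c E) : ∀ R : ℕ, T c.u = x →
    (∀ k : ℕ, k < R → T (c.l - k) = y) → Stuck F x y c.s → E.l ≤ c.l - R →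
    ∃ s2, UP (mF F) x (List.replicate R y) c.s s2 0 ∧ Reach F T ⟨s2, c.u, c.l - R⟩ E := by
  induction h using ReflTransGen.head_induction_on with
  | refl =>
    intro R _ _ _ hR
    have : R = 0 := by omega
    subst this
    exact ⟨_, .nil _, by simp; exact .refl⟩
  | @head c c1 hc hr ih =>
    intro R hx hy hs hE
    rcases R with _ | R
    · exact ⟨_, .nil _, by simp; exact .head hc hr⟩
    have hy0 := hy 0 (by omega)
    simp at hy0
    obtain ⟨d1, d2, h1, h2, h3⟩ := hc
    rw [hx, hy0] at h1
    cases d1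
    swap
    · exact absurd (UP.move h1 (.nil _)) (hs _ _)
    have hs1 : Stuck F x y c1.s := fun z δ h => hs _ _ (.stay h1 h)
    simp at h2
    have hm : mF F c.s y x = some (c1.s, d2, false) := by simp [mF, h1]
    cases d2
    · simp at h3
      obtain ⟨s2, g1, g2⟩ := ih (R+1) (by rw [h2]; exact hx) (by rw [h3]; exact hy) hs1
        (by rw [h3]; exact hE)
      rw [h2, h3] at g2
      exact ⟨s2, .stay hm g1, g2⟩
    · simp at h3
      obtain ⟨s2, g1, g2⟩ := ih R (by rw [h2]; exact hx) (fun k hk => by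
          have := hy (k+1) (by omega)
          rw [← this, h3]; push_cast; ring_nf) hs1
        (by rw [h3]; push_cast at hE; omega)
      rw [h2, h3] at g2
      refine ⟨s2, .move hm g1, ?_⟩
      convert g2 using 2
      push_cast; ring

lemma path_of_UP0 {u : List A} {s s2 : S} {δ : ℕ} (h : UP (mF F) x u s s2 δ) (hδ : δ = 0) (R : ℕ)
    (hu : u = List.replicate R y) :
    ∃ (n : ℕ) (f : ℕ → S), R ≤ n ∧ f 0 = s ∧ ∀ i, i < n → StR F x y (f i) (f (i+1)) := by
  induction h generalizing R with
  | nil s =>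
    refine ⟨0, fun _ => s, ?_, rfl, by simp⟩
    rcases R with _ | R
    · simp
    · simp [List.replicate_succ] at hu
  | @stay x' u s s1 s' d δ e h ih =>
    rcases R with _ | R
    · simp at hu
    have hu' := hu
    rw [List.replicate_succ] at hu
    simp at hu
    obtain ⟨rfl, _⟩ := hu
    obtain ⟨n, f, h1, h2, h3⟩ := ih (by omega) _ hu'
    have hd : d = false := by cases d <;> simp at hδ ⊢
    subst hd
    simp only [mF, Option.map_eq_some_iff, Prod.exists, Prod.mk.injEq] at e
    obtain ⟨_, _, _, e, rfl, rfl, rfl⟩ := e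
    refine ⟨n + 1, fun i => Nat.casesOn i s f, by omega, rfl, fun i hi => ?_⟩
    rcases i with _ | i
    · simp only [h2]; exact ⟨_, e⟩
    · exact h3 i (by omega)
  | @move x' u s s1 s' d δ e h ih =>
    rcases R with _ | R
    · simp at hu
    rw [List.replicate_succ] at hu
    simp at hu
    obtain ⟨rfl, hu⟩ := hu
    obtain ⟨n, f, h1, h2, h3⟩ := ih (by omega) _ hu
    have hd : d = false := by cases d <;> simp at hδ ⊢
    subst hd
    simp only [mF, Option.map_eq_some_iff, Prod.exists, Prod.mk.injEq] at e
    obtain ⟨_, _, _, e, rfl, rfl, rfl⟩ := e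
    refine ⟨n + 1, fun i => Nat.casesOn i s f, by omega, rfl, fun i hi => ?_⟩
    rcases i with _ | i
    · simp only [h2]; exact ⟨_, e⟩
    · exact h3 i (by omega)

lemma StuckContr [Fintype S] (hI : Inj F) {s s2 : S} {R : ℕ} (hs : Arrv F x y s)
    (h : UP (mF F) x (List.replicate R y) s s2 0) (hR : Fintype.card S ≤ R) : False := by
  obtain ⟨n, f, h1, rfl, h3⟩ := path_of_UP0 (y := y) h rfl R rfl
  obtain ⟨D, g1, g2, g3⟩ := orbit n f (by omega) (by
    intro i j hi hj hij
    obtain ⟨d, a⟩ := h3 i hi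
    obtain ⟨d', b⟩ := h3 j hj
    rw [hij] at a
    exact hI _ _ _ _ _ _ _ _ _ a b)
  obtain ⟨D, rfl⟩ : ∃ D', D = D' + 1 := ⟨D - 1, by omega⟩
  obtain ⟨d, a⟩ := h3 D (by omega)
  obtain ⟨t, d', b⟩ := hs
  rw [g3] at a
  have := hI _ _ _ _ _ _ _ _ _ a b
  subst this
  rw [a] at b; simp at b

end per
end PWKaux

namespace PWKaux

section chain
variable {S A : Type}

/-- lists of blocks: a letter, and its multiplicity in the two words -/
def flat : List (A × ℕ × ℕ) → List A
  | [] => []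
  | b :: β => List.replicate b.2.1 b.1 ++ flat β
def flat' : List (A × ℕ × ℕ) → List A
  | [] => []
  | b :: β => List.replicate b.2.2 b.1 ++ flat' β

lemma flat_append (β γ : List (A × ℕ × ℕ)) : flat (β ++ γ) = flat β ++ flat γ := by
  induction β with
  | nil => rfl
  | cons b β ih => simp [flat, ih]
lemma flat'_append (β γ : List (A × ℕ × ℕ)) : flat' (β ++ γ) = flat' β ++ flat' γ := by
  induction β with
  | nil => rfl
  | cons b β ih => simp [flat', ih]

open Nat in
def GoodB (N : ℕ) (b : A × ℕ × ℕ) : Prop :=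
  1 ≤ b.2.1 ∧ 1 ≤ b.2.2 ∧ (b.2.1 = b.2.2 ∨ (N < b.2.1 ∧ b.2.1 ≡ b.2.2 [MOD N ! * N !]))

variable {F : Sys S A} {T T' : ℤ → A}

lemma realize0 {x y : A} {R : ℕ} {s s2 : S} (h : UP (mF F) x (List.replicate R y) s s2 0)
    (p q : ℤ) (hx : T p = x) (hy : ∀ k : ℕ, k < R → T (q - k) = y) :
    Reach F T ⟨s, p, q⟩ ⟨s2, p, q - R⟩ := by
  have := h.realize (T := mT T) (-q) (-p) (by
    rw [Rd_replicate]
    intro k hk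
    rw [← hy k hk, mT]; congr 1; ring) (by
    intro k hk
    have : k = 0 := by omega
    subst this
    simp [mT, hx])
  have := Reach.mirror' this
  simp [mc] at this
  convert this using 2
  ring

open Nat in
lemma R_one [Fintype S] (hI : Inj F) {C : ℕ} (hC : HC F C) {y : A} {E : Cfg S}
    (β : List (A × ℕ × ℕ)) : ∀ (s : S) (p p1 q q1 : ℤ) (R0 R1 : ℕ),
    (∀ b ∈ β, GoodB (Fintype.card S) b) →
    Rd T p (flat β) → Rd T' p1 (flat' β) →
    (∀ k : ℕ, k < R0 → T (q - k) = y) → (∀ k : ℕ, k < R1 → T' (q1 - k) = y) →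
    R0 ≡ R1 [MOD (Fintype.card S)!] →
    C * (flat β).length + Fintype.card S < R0 → C * (flat' β).length + Fintype.card S < R1 →
    Reach F T ⟨s, p, q⟩ E → E.l ≤ q - R0 → E.u < p + (flat β).length →
    ∃ β1 β2 s2, β = β1 ++ β2 ∧
      Reach F T ⟨s, p, q⟩ ⟨s2, p + (flat β1).length, q - R0⟩ ∧
      Reach F T ⟨s2, p + (flat β1).length, q - R0⟩ E ∧
      Reach F T' ⟨s, p1, q1⟩ ⟨s2, p1 + (flat' β1).length, q1 - R1⟩ := by
  induction β with
  | nil =>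
    intro s p p1 q q1 R0 R1 _ _ _ _ _ _ _ _ hE _ hEu
    have := (Reach.mono hE).1
    simp [flat] at hEu
    simp at this
    omega
  | cons b β ih =>
    obtain ⟨x, r, r'⟩ := b
    intro s p p1 q q1 R0 R1 hG h1 h2 h3 h4 hmod hR0 hR1 hE hEl hEu
    have hg := hG _ (List.mem_cons_self)
    simp only [GoodB] at hg
    obtain ⟨g1, g2, g3⟩ := hg
    simp only [flat, flat', Rd_append, List.length_append, List.length_replicate] at *
    obtain ⟨h1a, h1b⟩ := h1
    obtain ⟨h2a, h2b⟩ := h2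
    have h1a' := Rd_replicate.1 h1a
    have h2a' := Rd_replicate.1 h2a
    by_cases hst : Stuck F x y s
    · obtain ⟨s2, k1, k2⟩ := StuckPass (x := x) (y := y) hE R0 (by simpa using h1a' 0 (by omega))
        h3 hst hEl
      refine ⟨[], _, s2, rfl, ?_, ?_, ?_⟩
      · simpa [flat] using realize0 k1 p q (by simpa using h1a' 0 (by omega)) h3
      · simpa [flat] using k2
      · obtain ⟨δ', k3, _⟩ := PER (r' := R1) (Inj.mirror hI) 1 k1 (by omega) (by omega) (by simpa using hmod)
        rw [hst.drift k3] at k3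
        simpa [flat'] using realize0 k3 p1 q1 (by simpa using h2a' 0 (by omega)) h4
    · have key : ∀ m, 1 ≤ m → m ≤ r → ∃ s' δ, UP F y (List.replicate m x) s s' δ := by
        intro m hm
        induction m, hm using Nat.le_induction with
        | base =>
          intro _
          simp only [Stuck, not_forall, not_not] at hst
          exact hst
        | succ m hm ihm =>
          intro hmr
          obtain ⟨s', δ, hu⟩ := ihm (by omega)
          by_cases hst' : Stuck F x y s'
          · exfalso
            have hδ := hC.le hu
            simp only [List.length_replicate] at hδ
            have hδ' : C * m ≤ C * r := Nat.mul_le_mul_left _ (by omega)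
            have hexp : C * (r + (flat β).length) = C * r + C * (flat β).length := by ring
            have hre := hu.realize (T := T) p q (Rd_replicate.2 fun k hk => h1a' k (by omega))
              (fun k hk => h3 k (by omega))
            have hE' : Reach F T ⟨s', p + m, q - δ⟩ E := by
              simpa using Reach.ord_l hre hE (by simp; omega)
            obtain ⟨s2, k1, _⟩ := StuckPass (x := x) (y := y) hE' (R0 - δ) (h1a' m (by omega))
              (fun k hk => by
                rw [← h3 (δ + k) (by omega)]; simp only; congr 1; push_cast; ring) hst'
              (by simp only; rw [Nat.cast_sub (by omega)]; omega)
            obtain ⟨m, rfl⟩ : ∃ m', m = m' + 1 := ⟨m - 1, by omega⟩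
            obtain ⟨_, _, _, _, l1, _⟩ := hu.replicate_split
            obtain ⟨t, d, _, ht⟩ := l1.last
            exact StuckContr hI ⟨t, d, ht⟩ k1 (by omega)
          · simp only [Stuck, not_forall, not_not] at hst'
            obtain ⟨z, δ', hz⟩ := hst'
            exact ⟨z, _, hu.replicate_add (n := 1) hz⟩
      obtain ⟨s', δ, hu⟩ := key r g1 le_rfl
      obtain ⟨δ', hu', hδδ⟩ : ∃ δ', UP F y (List.replicate r' x) s s' δ' ∧
          δ ≡ δ' [MOD (Fintype.card S)!] := by
        rcases g3 with rfl | ⟨g3, g4⟩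
        · exact ⟨δ, hu, rfl⟩
        · exact PER hI _ hu g3 g2 g4
      have hδ := hC.le hu
      have hδ' := hC.le hu'
      simp only [List.length_replicate] at hδ hδ'
      have hexp : C * (r + (flat β).length) = C * r + C * (flat β).length := by ring
      have hexp' : C * (r' + (flat' β).length) = C * r' + C * (flat' β).length := by ring
      have hre := hu.realize (T := T) p q h1a (fun k hk => h3 k (by omega))
      have hre' := hu'.realize (T := T') p1 q1 h2a (fun k hk => h4 k (by omega))
      have hE' := Reach.ord_l hre hE (by simp; omega)
      simp only [List.length_replicate] at hre hre' hE'
      obtain ⟨β1, β2, s2, e1, e2, e3, e4⟩ := ih s' (p + r) (p1 + r') (q - δ) (q1 - δ')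
        (R0 - δ) (R1 - δ') (fun b hb => hG b (List.mem_cons_of_mem _ hb))
        (by simpa using h1b) (by simpa using h2b)
        (fun k hk => by
          rw [← h3 (δ + k) (by omega)]; congr 1; push_cast; ring)
        (fun k hk => by
          rw [← h4 (δ' + k) (by omega)]; congr 1; push_cast; ring)
        (by
          apply Nat.ModEq.add_right_cancel hδδ
          rwa [Nat.sub_add_cancel (by omega), Nat.sub_add_cancel (by omega)])
        (by omega) (by omega) hE'
        (by rw [Nat.cast_sub (by omega)]; omega) (by push_cast at hEu; omega)
      have q0 : q - δ - ((R0 - δ : ℕ) : ℤ) = q - R0 := by rw [Nat.cast_sub (by omega)]; ring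
      have q1' : q1 - δ' - ((R1 - δ' : ℕ) : ℤ) = q1 - R1 := by rw [Nat.cast_sub (by omega)]; ring
      rw [q0] at e2 e3
      rw [q1'] at e4
      refine ⟨(x, r, r') :: β1, β2, s2, by simp [e1], ?_, ?_, ?_⟩
      · refine hre.trans ?_
        simpa [flat, add_assoc] using e2
      · simpa [flat, add_assoc] using e3
      · refine hre'.trans ?_
        simpa [flat', add_assoc] using e4

open Nat in
lemma R_chain [Fintype S] (hI : Inj F) {C : ℕ} (hC : HC F C) {E : Cfg S} {L : ℕ} (J : ℕ) :
    ∀ (β : List (A × ℕ × ℕ)) (Y : ℕ → A) (s : S) (p p1 q : ℤ),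
    (∀ b ∈ β, GoodB (Fintype.card S) b) →
    Rd T p (flat β) → Rd T' p1 (flat' β) →
    (∀ i k : ℕ, i < J → k < L → T (q - (L * i + k)) = Y i) →
    (∀ i k : ℕ, i < J → k < L → T' (q - (L * i + k)) = Y i) →
    C * (flat β).length + Fintype.card S < L → C * (flat' β).length + Fintype.card S < L →
    Reach F T ⟨s, p, q⟩ E → E.l ≤ q - L * J → E.u < p + (flat β).length →
    ∃ β1 β2 s2, β = β1 ++ β2 ∧
      Reach F T ⟨s, p, q⟩ ⟨s2, p + (flat β1).length, q - L * J⟩ ∧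
      Reach F T ⟨s2, p + (flat β1).length, q - L * J⟩ E ∧
      Reach F T' ⟨s, p1, q⟩ ⟨s2, p1 + (flat' β1).length, q - L * J⟩ := by
  induction J with
  | zero =>
    intro β Y s p p1 q _ _ _ _ _ _ _ hE _ _
    refine ⟨[], β, s, rfl, ?_, ?_, ?_⟩
    · simp [flat]; exact .refl
    · simpa [flat] using hE
    · simp [flat']; exact .refl
  | succ J ih =>
    intro β Y s p p1 q hG h1 h2 h3 h4 hL hL' hE hEl hEu
    have hLJ : (0:ℤ) ≤ L * J := by positivity
    push_cast at hEl
    obtain ⟨β1, β2, s2, rfl, e2, e3, e4⟩ := R_one hI hC (y := Y 0) β s p p1 q q L L hG h1 h2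
      (fun k hk => by simpa using h3 0 k (by omega) hk)
      (fun k hk => by simpa using h4 0 k (by omega) hk) rfl hL hL' hE
      (by nlinarith) hEu
    rw [flat_append, List.length_append] at hL hEu
    rw [flat'_append, List.length_append] at hL'
    rw [flat_append, Rd_append] at h1
    rw [flat'_append, Rd_append] at h2
    have a1 : C * (flat β2).length ≤ C * ((flat β1).length + (flat β2).length) :=
      Nat.mul_le_mul_left _ (by omega)
    have a2 : C * (flat' β2).length ≤ C * ((flat' β1).length + (flat' β2).length) :=
      Nat.mul_le_mul_left _ (by omega)
    push_cast at hEu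
    obtain ⟨γ1, γ2, s3, rfl, f2, f3, f4⟩ := ih β2 (fun i => Y (i + 1)) s2 (p + (flat β1).length)
      (p1 + (flat' β1).length) (q - L) (fun b hb => hG b (List.mem_append_right _ hb))
      h1.2 h2.2
      (fun i k hi hk => by
        rw [← h3 (i + 1) k (by omega) hk]; congr 1; push_cast; ring)
      (fun i k hi hk => by
        rw [← h4 (i + 1) k (by omega) hk]; congr 1; push_cast; ring)
      (by omega) (by omega) e3 (by linarith) (by omega)
    have q0 : q - L - (L : ℤ) * J = q - L * ((J + 1 : ℕ) : ℤ) := by push_cast; ring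
    rw [q0] at f2 f3 f4
    refine ⟨β1 ++ γ1, γ2, s3, by simp, ?_, ?_, ?_⟩
    · refine e2.trans ?_
      simpa [flat_append, add_assoc] using f2
    · simpa [flat_append, add_assoc] using f3
    · refine e4.trans ?_
      simpa [flat'_append, add_assoc] using f4

end chain
end PWKaux

namespace PWKaux

section win
variable {S A : Type}

structure Scene (F : Sys S A) (T : ℤ → A) (init fin : Cfg S) (Pp : ℤ → Prop) : Prop where
  hI : Inj F
  reach : Reach F T init fin
  halt : ∀ d, ¬ Stp F T fin d
  conv : ∀ a z b, a ≤ z → z ≤ b → ¬ Pp a → ¬ Pp b → ¬ Pp z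
  never : ∀ c, Reach F T init c → Pp c.u → ¬ Pp c.l

/-- The modification of the tape: a zone `b^k v b^k` is replaced. -/
def ZW (T T' : ℤ → A) (b : A) (K : ℕ) (g0 g1 : ℤ) : Prop :=
  ∃ v : List A, g1 = g0 + 2 * (K + 1) + v.length ∧
    Rd T g0 (List.replicate (K+1) b ++ v ++ List.replicate (K+1) b) ∧
    (Rd T' g0 ([b] ++ v ++ List.replicate (2*K+1) b) ∨
      Rd T' g0 (List.replicate (2*K+1) b ++ v ++ [b])) ∧
    ∀ z, z < g0 ∨ g1 ≤ z → T' z = T z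

/-- states in which the upper head arrives at position `x` -/
def Arr (F : Sys S A) (T : ℤ → A) (init : Cfg S) (x : ℤ) (s : S) : Prop :=
  ∃ c d, Reach F T init c ∧ Stp F T c d ∧ c.u = x - 1 ∧ d.u = x ∧ d.s = s

def NQ (F : Sys S A) (T : ℤ → A) (init : Cfg S) (G0 G1 : ℤ) : Prop :=
  ∃ c d, Reach F T init c ∧ Stp F T c d ∧ G0 ≤ c.u ∧ d.u < G1 ∧ T c.l ≠ T d.l

def Win (F : Sys S A) (T T' : ℤ → A) (init fin : Cfg S) (g0 g1 : ℤ) (Pp : ℤ → Prop) : Prop :=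
  fin.u < g0 ∨ ∃ a d, Reach F T init a ∧ Reach F T a d ∧ Reach F T d fin ∧ Reach F T' a d ∧
    a.u < g0 ∧ g1 ≤ d.u ∧ Pp a.u ∧ Pp d.u

variable {F : Sys S A} {T T' : ℤ → A} {init fin : Cfg S} {Pp : ℤ → Prop}

lemma Scene.mirror (h : Scene F T init fin Pp) :
    Scene (mF F) (mT T) (mc init) (mc fin) (fun z => Pp (-z)) where
  hI := h.hI.mirror
  reach := Reach.mirror h.reach
  halt := fun d hd => h.halt (mc d) (by simpa using hd.mirror')
  conv := fun a z b h1 h2 h3 h4 => h.conv (-b) (-z) (-a) (by omega) (by omega) h4 h3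
  never := fun c hc h1 h2 => h.never (mc c) (by simpa using Reach.mirror' hc) (by simpa using h2)
    (by simpa using h1)

lemma Scene.toFin (h : Scene F T init fin Pp) {c : Cfg S} (hc : Reach F T init c) :
    Reach F T c fin := by
  rcases Reach.total hc h.reach with h1 | h1
  · exact h1
  · rcases h1.cases_head with h1 | ⟨x, hx, _⟩
    · subst h1; exact .refl
    · exact absurd hx (h.halt _)

lemma ZW.mirror {b : A} {K : ℕ} {g0 g1 : ℤ} (h : ZW T T' b K g0 g1) :
    ZW (mT T) (mT T') b K (1 - g1) (1 - g0) := by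
  obtain ⟨v, h1, h2, h3, h4⟩ := h
  refine ⟨v.reverse, by simp; omega, ?_, ?_, ?_⟩
  · have := Rd_mirror h2
    simp only [List.reverse_append, List.reverse_replicate, List.length_append,
      List.length_replicate] at this
    rw [List.append_assoc]
    convert this using 1
    push_cast; omega
  · rcases h3 with h3 | h3
    · right
      have := Rd_mirror h3
      simp only [List.reverse_append, List.reverse_replicate, List.length_append,
        List.length_replicate, List.reverse_singleton, List.length_singleton] at this
      rw [List.append_assoc]
      convert this using 1
      push_cast; omega
    · left
      have := Rd_mirror h3
      simp only [List.reverse_append, List.reverse_replicate, List.length_append,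
        List.length_replicate, List.reverse_singleton, List.length_singleton] at this
      rw [List.append_assoc]
      convert this using 1
      push_cast; omega
  · intro z hz
    exact h4 (-z) (by omega)

lemma Arr.det {x : ℤ} {s s' : S} (h : Arr F T init x s) (h' : Arr F T init x s') : s = s' := by
  obtain ⟨c, d, h1, h2, h3, h4, rfl⟩ := h
  obtain ⟨c', d', g1, g2, g3, g4, rfl⟩ := h'
  have e1 : Reach F T c c' := Reach.ord_step h1 g1 g2 (by omega)
  have e2 : Reach F T c' c := Reach.ord_step g1 h1 h2 (by omega)
  rcases e1.cases_head with e | ⟨e, he, he'⟩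
  · subst e; rw [h2.det g2]
  · have := he.det h2
    subst this
    have := Reach.mono he'
    omega

open Nat in
/-- the quiet window -/
lemma WQ [Fintype S] (h : Scene F T init fin Pp) {G0 G1 g0 g1 : ℤ} {b : A} {K : ℕ}
    (hi : init.u < G0) (hG0 : G0 < g0) (hG1 : g1 < G1) (hf : fin.u < G0 ∨ G1 ≤ fin.u)
    (hP : ∀ z, G0 ≤ z → z < G1 → Pp z) (hq : ¬ NQ F T init G0 G1) (hz : ZW T T' b K g0 g1)
    (hK1 : Fintype.card S ≤ K) (hK2 : (Fintype.card S)! ∣ K)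
    (harr : ∀ s s', Arr F T init (g0 + 1) s → Arr F T init (g1 - K) s' → s = s') :
    Win F T T' init fin g0 g1 Pp := by
  by_cases hfg : fin.u < g0
  · exact Or.inl hfg
  right
  obtain ⟨v, hv, hT, hT', hout⟩ := hz
  have hfG : G1 ≤ fin.u := by omega
  obtain ⟨c0, d0, p1, p2, p3, p4, p5⟩ := Reach.arrive h.reach g0 (by omega) (by omega)
  obtain ⟨c1, d1, q1, q2, q3, q4, q5⟩ := Reach.arrive p3 (g0+1) (by omega) (by omega)
  obtain ⟨c2, d2, r1, r2, r3, r4, r5⟩ := Reach.arrive q3 (g1-K) (by omega) (by omega)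
  have hpos : 0 < Fintype.card S := Fintype.card_pos_iff.2 ⟨init.s⟩
  obtain ⟨c3, d3, s1, s2, s3, s4, s5⟩ := Reach.arrive r3 g1 (by omega) (by omega)
  have hid0 : Reach F T init d0 := p1.tail p2
  have h01 : Reach F T d0 d1 := q1.tail q2
  have h12 : Reach F T d1 d2 := r1.tail r2
  have h23 : Reach F T d2 d3 := s1.tail s2
  have h03 : Reach F T d0 d3 := (h01.trans h12).trans h23
  have hconst : ∀ e, Reach F T d0 e → Reach F T e d3 → T e.l = T d0.l := by
    apply Reach.const h03
    intro e f he hef hf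
    by_contra hne
    have m1 := Reach.mono he
    have m2 := Reach.mono hf
    exact hq ⟨e, f, hid0.trans he, hef, by omega, by omega, hne⟩
  have hvis := Reach.visit h03 (fun z => T z = T d0.l ∧ ¬ Pp z) (fun e h1 h2 => by
    have m1 := Reach.mono h1
    have m2 := Reach.mono h2
    exact ⟨hconst e h1 h2, h.never e (hid0.trans h1) (hP _ (by omega) (by omega))⟩)
  have hout' : ∀ z, ¬ Pp z → T' z = T z := by
    intro z hz
    apply hout
    by_contra hcon
    exact hz (hP z (by omega) (by omega))
  set y := T d0.l with hy
  have w1 : Rd T g0 ([b] ++ (List.replicate K b ++ v ++ [b]) ++ List.replicate K b) := by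
    convert hT using 1
    rw [show K + 1 = 1 + K by ring, List.replicate_add]
    simp
  rw [Rd_append, Rd_append] at w1
  obtain ⟨⟨w1, w2⟩, w3⟩ := w1
  simp only [List.length_append, List.length_replicate, List.length_singleton] at w2 w3
  push_cast at w2 w3
  obtain ⟨δ1, u1, x1⟩ := UP.extract (y := y) q1 q2 (by omega) [b] (by simp; omega)
    (by rw [p5]; exact w1) (fun e h1 h2 => hconst e h1 (((h2.tail q2).trans h12).trans h23))
  obtain ⟨δ2, u2, x2⟩ := UP.extract (y := y) r1 r2 (by omega) (List.replicate K b ++ v ++ [b])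
    (by simp; omega) (by rw [q5]; exact w2)
    (fun e h1 h2 => hconst e (h01.trans h1) ((h2.tail r2).trans h23))
  obtain ⟨δ3, u3, x3⟩ := UP.extract (y := y) s1 s2 (by omega) (List.replicate K b)
    (by simp; omega) (by rw [r5]; convert w3 using 1; omega)
    (fun e h1 h2 => hconst e ((h01.trans h12).trans h1) (h2.tail s2))
  have he : d1.s = d2.s := harr _ _ ⟨c1, d1, hid0.trans q1, q2, by omega, q5, rfl⟩
    ⟨c2, d2, (hid0.trans h01).trans r1, r2, by omega, r5, rfl⟩
  rw [← he] at u2 u3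
  have hA : Arrv F b y d1.s := by
    obtain ⟨t, d, _, ht⟩ := u1.last; exact ⟨t, d, ht⟩
  obtain ⟨κ, hκ⟩ := per' h.hI hA u3 hK1
  obtain ⟨m, hm⟩ := hK2
  have hκ := hκ.iter m
  rw [← hm] at hκ
  obtain ⟨e3, rfl⟩ := u3.det hκ
  rw [List.append_assoc] at u2
  obtain ⟨t, a1, a2, b1, b2, rfl⟩ := u2.split
  obtain ⟨rfl, rfl⟩ := b1.det hκ
  rw [e3] at u3
  have hdrift : d0.l - d3.l = (δ1 + (κ * m + a2) + κ * m : ℕ) := by push_cast at *; omega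
  have hfinal : Reach F T' d0 d3 := by
    have hl : ∀ k : ℕ, k ≤ (δ1 + (κ * m + a2) + κ * m : ℕ) → T' (d0.l - k) = y := by
      intro k hk
      obtain ⟨z1, z2⟩ := hvis (d0.l - k) (by omega) (by omega)
      rw [hout' _ z2, z1]
    have e0 : d0 = ⟨d0.s, g0, d0.l⟩ := by ext <;> simp [p5]
    have e3' : d3 = ⟨d1.s, g1, d0.l - (δ1 + (κ * m + a2) + κ * m : ℕ)⟩ := by
      ext
      · exact e3
      · exact s5
      · simp only; omega
    rw [e0, e3']
    rcases hT' with hT' | hT'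
    · have hu := ((u1.append b2).append u3).append u3
      have := hu.realize (T := T') g0 d0.l (by
        convert hT' using 1
        rw [show 2 * K + 1 = 1 + K + K by ring, List.replicate_add, List.replicate_add]
        simp) (fun k hk => hl k (by omega))
      convert this using 2
      · simp; omega
      · push_cast; ring
    · have hu := ((u1.append u3).append u3).append b2
      have := hu.realize (T := T') g0 d0.l (by
        convert hT' using 1
        rw [show 2 * K + 1 = 1 + K + K by ring, List.replicate_add, List.replicate_add]
        simp) (fun k hk => hl k (by omega))
      convert this using 2
      · simp; omega
      · push_cast; ring
  refine ⟨c0, d3, p1, .head p2 h03, s3, .head ?_ hfinal, by omega, by omega,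
    hP _ (by omega) (by omega), hP _ (by omega) (by omega)⟩
  obtain ⟨d1, d2, z1, z2, z3⟩ := p2
  refine ⟨d1, d2, ?_, z2, z3⟩
  rw [hout c0.u (by omega), hout' c0.l (h.never c0 p1 (hP _ (by omega) (by omega)))]
  exact z1

end win
end PWKaux

namespace PWKaux

section ru
variable {S A : Type}

def cells (T : ℤ → A) (p : ℤ) (n : ℕ) : List A := (List.range n).map (fun i : ℕ => T (p + i))

lemma cells_length (T : ℤ → A) (p : ℤ) (n : ℕ) : (cells T p n).length = n := by simp [cells]

lemma Rd_cells (T : ℤ → A) (p : ℤ) (n : ℕ) : Rd T p (cells T p n) := by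
  rw [Rd_iff]
  intro k x hk
  simp only [cells, List.getElem?_map, Option.map_eq_some_iff] at hk
  obtain ⟨a, h1, rfl⟩ := hk
  rw [List.getElem?_eq_some_iff] at h1
  obtain ⟨h, h1⟩ := h1
  simp at h1
  rw [h1]

def sing (u : List A) : List (A × ℕ × ℕ) := u.map (fun x => (x, 1, 1))

lemma flat_sing (u : List A) : flat (sing u) = u := by
  induction u with
  | nil => rfl
  | cons x u ih => simp [sing, flat] at *; exact ih
lemma flat'_sing (u : List A) : flat' (sing u) = u := by
  induction u with
  | nil => rfl
  | cons x u ih => simp [sing, flat'] at *; exact ih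
lemma good_sing (N : ℕ) (u : List A) : ∀ b ∈ sing u, GoodB N b := by
  intro b hb
  simp only [sing, List.mem_map] at hb
  obtain ⟨x, _, rfl⟩ := hb
  simp [GoodB]

variable {F : Sys S A} {T T' : ℤ → A} {init fin : Cfg S} {Pp : ℤ → Prop}

/-- Prefixes of the block list beyond the modified part have equal lengths. -/
lemma initseg_len {βp β1 β2 : List (A × ℕ × ℕ)} {u : List A} (hg : ∀ b ∈ βp, 1 ≤ b.2.1)
    (he : βp ++ sing u = β1 ++ β2) (hlen : (flat βp).length = (flat' βp).length)
    (hle : (flat βp).length ≤ (flat β1).length) : (flat' β1).length = (flat β1).length := by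
  rcases List.append_eq_append_iff.1 he with ⟨c, rfl, hc⟩ | ⟨c, rfl, hc⟩
  · have : ∃ u', c = sing u' := by
      refine ⟨u.take c.length, ?_⟩
      have := congrArg (List.take c.length) hc
      simp [sing] at this
      rw [sing, List.map_take]
      exact this.symm
    obtain ⟨u', rfl⟩ := this
    simp [flat_append, flat'_append, flat_sing, flat'_sing, hlen]
  · rw [flat_append, List.length_append] at hle
    rcases c with _ | ⟨b, c⟩
    · simpa using hlen.symm
    · exfalso
      have := hg b (by simp)
      simp [flat] at hle
      omega

open Nat in
lemma RU [Fintype S] (h : Scene F T init fin Pp) {C L : ℕ} (hC : HC F C) {q0 g0 g1 pe : ℤ} {b : A}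
    {K : ℕ}
    (hgi : ∀ z, ¬ Pp z → ¬ Pp (z - 1) → T z ≠ T (z - 1) → ∃ i : ℤ, z - 1 = q0 + L * i)
    (hz : ZW T T' b K g0 g1) (hzP : ∀ z, g0 ≤ z → z < g1 → Pp z)
    (hK1 : Fintype.card S ≤ K) (hK2 : (Fintype.card S)! * (Fintype.card S)! ∣ K)
    {c0 C0 B E : Cfg S} (h0 : Reach F T init c0) (h0' : Stp F T c0 C0) (hne0 : T c0.l ≠ T C0.l)
    (hC0 : C0.u < g0) (hc0P : Pp c0.u) (hC0P : Pp C0.u)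
    (hB : Reach F T init B) (hB' : Stp F T B E) (hneB : T B.l ≠ T E.l) (hBg : g1 ≤ B.u)
    (hBP : Pp B.u) (hEP : Pp E.u) (hEpe : E.u < pe)
    (hL : C * (pe - C0.u) + Fintype.card S < L) :
    Win F T T' init fin g0 g1 Pp := by
  right
  obtain ⟨v, hv, hT, hT', hout⟩ := hz
  have hiC0 : Reach F T init C0 := h0.tail h0'
  have hiE : Reach F T init E := hB.tail hB'
  have hCB : Reach F T C0 B := Reach.ord_u hiC0 hB (by omega)
  have n1 := h.never _ h0 hc0P
  have n2 := h.never _ hiC0 hC0P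
  have n3 := h.never _ hB hBP
  have n4 := h.never _ hiE hEP
  have hfresh : ∀ c d : Cfg S, Stp F T c d → T c.l ≠ T d.l → ¬ Pp c.l → ¬ Pp d.l →
      d.l = c.l - 1 ∧ ∃ i : ℤ, d.l = q0 + L * i := by
    intro c d hs hne hc hd
    have := hs.mono
    have hcd : d.l = c.l - 1 := by
      by_contra hcon
      have : c.l = d.l := by omega
      rw [this] at hne; exact hne rfl
    rw [hcd] at hd hne ⊢
    exact ⟨rfl, hgi _ hc hd hne⟩
  obtain ⟨e0, i1, hi1⟩ := hfresh _ _ h0' hne0 n1 n2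
  obtain ⟨eB, i2, hi2⟩ := hfresh _ _ hB' hneB n3 n4
  have mCB := Reach.mono hCB
  have mBE := hB'.mono
  have hLpos : (0 : ℤ) < L := by
    have : (0:ℤ) ≤ C * (pe - C0.u) := mul_nonneg (by positivity) (by omega)
    omega
  have hlt : i2 < i1 := by
    by_contra hcon
    have : (L:ℤ) * i1 ≤ L * i2 := mul_le_mul_of_nonneg_left (by omega) hLpos.le
    omega
  obtain ⟨J, hJ⟩ : ∃ J : ℕ, i1 = i2 + J := ⟨(i1 - i2).toNat, by omega⟩
  have hEl : E.l = C0.l - L * J := by rw [hi1, hi2, hJ]; ring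
  have hletter : ∀ i k : ℕ, i < J → k < L → ¬ Pp (C0.l - (L * i + k)) ∧
      T (C0.l - (L * i + k)) = T (C0.l - L * i) := by
    intro i k hi hk
    have hcv : ∀ k : ℕ, k < L → ¬ Pp (C0.l - (L * i + k)) := by
      intro k hk
      apply h.conv E.l _ C0.l _ _ n4 n2
      · have : (L:ℤ) * (i + 1) ≤ L * J := mul_le_mul_of_nonneg_left (by omega) hLpos.le
        rw [hEl]; linarith
      · have : (0:ℤ) ≤ L * i := by positivity
        omega
    refine ⟨hcv k hk, ?_⟩
    induction k with
    | zero => simp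
    | succ k ih =>
      rw [← ih (by omega)]
      by_contra hne
      have hk1 := hcv (k+1) hk
      have hk0 := hcv k (by omega)
      have ee : C0.l - ((L:ℤ) * i + ((k + 1 : ℕ) : ℤ)) = C0.l - (L * i + k) - 1 := by
        push_cast; ring
      rw [ee] at hk1 hne
      obtain ⟨j, hj⟩ := hgi _ hk0 hk1 (Ne.symm hne)
      have : (L : ℤ) * (i1 - i - j) = k + 1 := by rw [hi1] at hj; linarith
      have h1 : 0 < i1 - i - j := by
        by_contra hcon
        have : (L:ℤ) * (i1 - i - j) ≤ 0 := mul_nonpos_of_nonneg_of_nonpos hLpos.le (by omega)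
        omega
      have h2 : (L:ℤ) * 1 ≤ L * (i1 - i - j) := mul_le_mul_of_nonneg_left (by omega) hLpos.le
      omega
  have hout' : ∀ z, ¬ Pp z → T' z = T z := by
    intro z hz
    apply hout
    by_contra hcon
    exact hz (hzP z (by omega) (by omega))
  have hmod1 : K + 1 ≡ 1 [MOD (Fintype.card S)! * (Fintype.card S)!] := by
    apply Nat.ModEq.symm
    rw [Nat.modEq_iff_dvd' (by omega)]
    simpa using hK2
  have hmod2 : K + 1 ≡ 2 * K + 1 [MOD (Fintype.card S)! * (Fintype.card S)!] := by
    rw [Nat.modEq_iff_dvd' (by omega)]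
    have : 2 * K + 1 - (K + 1) = K := by omega
    rw [this]; exact hK2
  obtain ⟨r1, r2, hr, hg1, hg2, hT2⟩ : ∃ r1 r2 : ℕ, r1 + r2 = 2 * (K + 1) ∧
      GoodB (Fintype.card S) (b, K + 1, r1) ∧ GoodB (Fintype.card S) (b, K + 1, r2) ∧
      Rd T' g0 (List.replicate r1 b ++ v ++ List.replicate r2 b) := by
    rcases hT' with hT' | hT'
    · refine ⟨1, 2 * K + 1, by ring, ?_, ?_, hT'⟩
      · exact ⟨by simp, by simp, Or.inr ⟨by simp; omega, hmod1⟩⟩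
      · exact ⟨by simp, by simp, Or.inr ⟨by simp; omega, hmod2⟩⟩
    · refine ⟨2 * K + 1, 1, by ring, ?_, ?_, hT'⟩
      · exact ⟨by simp, by simp, Or.inr ⟨by simp; omega, hmod2⟩⟩
      · exact ⟨by simp, by simp, Or.inr ⟨by simp; omega, hmod1⟩⟩
  obtain ⟨na, hna⟩ : ∃ n : ℕ, g0 = C0.u + n := ⟨(g0 - C0.u).toNat, by omega⟩
  obtain ⟨nb, hnb⟩ : ∃ n : ℕ, pe = g1 + n := ⟨(pe - g1).toNat, by omega⟩
  set βp : List (A × ℕ × ℕ) := sing (cells T C0.u na) ++ ((b, K + 1, r1) ::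
    (sing v ++ [(b, K + 1, r2)])) with hβp
  have hfp : flat βp = cells T C0.u na ++ (List.replicate (K+1) b ++ v ++ List.replicate (K+1) b) := by
    simp [hβp, flat_append, flat, flat_sing]
  have hfp' : flat' βp = cells T C0.u na ++ (List.replicate r1 b ++ v ++ List.replicate r2 b) := by
    simp [hβp, flat'_append, flat', flat'_sing]
  have hgood : ∀ x ∈ βp, GoodB (Fintype.card S) x := by
    intro x hx
    simp only [hβp, List.mem_append, List.mem_cons, List.not_mem_nil, or_false] at hx
    rcases hx with hx | rfl | hx | rfl
    · exact good_sing _ _ _ hx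
    · exact hg1
    · exact good_sing _ _ _ hx
    · exact hg2
  have hlp : ((flat βp).length : ℤ) = g1 - C0.u := by
    rw [hfp]; simp [cells_length]; omega
  have hlp' : (flat βp).length = (flat' βp).length := by
    rw [hfp, hfp']; simp [cells_length]; omega
  have hRT : Rd T C0.u (flat (βp ++ sing (cells T g1 nb))) := by
    rw [flat_append, flat_sing, Rd_append]
    constructor
    · rw [hfp, Rd_append]
      refine ⟨Rd_cells _ _ _, ?_⟩
      rw [cells_length, ← hna]; exact hT
    · convert Rd_cells T g1 nb using 1
      omega
  have hRT' : Rd T' C0.u (flat' (βp ++ sing (cells T g1 nb))) := by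
    rw [flat'_append, flat'_sing, Rd_append]
    constructor
    · rw [hfp', Rd_append]
      refine ⟨?_, ?_⟩
      · refine Rd_congr (Rd_cells T C0.u na) fun z h1 h2 => hout z ?_
        rw [cells_length] at h2; omega
      · rw [cells_length, ← hna]; exact hT2
    · refine Rd_congr (T := T) ?_ fun z h1 h2 => hout z ?_
      · convert Rd_cells T g1 nb using 1
        omega
      · omega
  have hlen : ((flat (βp ++ sing (cells T g1 nb))).length : ℤ) = pe - C0.u := by
    rw [flat_append, flat_sing, List.length_append, cells_length]; push_cast; omega
  have hlen' : ((flat' (βp ++ sing (cells T g1 nb))).length : ℤ) = pe - C0.u := by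
    rw [flat'_append, flat'_sing, List.length_append, cells_length]; push_cast; omega
  obtain ⟨β1, β2, s2, k1, k2, k3, k4⟩ := R_chain (F := F) (T := T) (T' := T') h.hI hC (E := E)
    (L := L) J
    (βp ++ sing (cells T g1 nb)) (fun i => T (C0.l - L * i)) C0.s C0.u C0.u C0.l
    (by
      intro x hx
      rcases List.mem_append.1 hx with hx | hx
      · exact hgood x hx
      · exact good_sing _ _ _ hx) hRT hRT'
    (fun i k hi hk => (hletter i k hi hk).2)
    (fun i k hi hk => by
      rw [hout' _ (hletter i k hi hk).1]; exact (hletter i k hi hk).2)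
    (by zify; rw [hlen]; exact hL) (by zify; rw [hlen']; exact hL)
    (hCB.tail hB') hEl.le (by rw [hlen]; omega)
  have hBD := Reach.ord_l hB (hiC0.trans k2) (by simp; omega)
  have m1 := Reach.mono hBD
  have m2 := Reach.mono k3
  simp only at m1 m2
  have hED : E.u ≤ C0.u + (flat β1).length := by
    rcases hBD.cases_head with e | ⟨x, hx, e⟩
    · exfalso
      have := congrArg Cfg.l e
      simp at this; omega
    · have := hx.det hB'
      subst this
      exact (Reach.mono e).1
  have hEq : C0.u + (flat β1).length = E.u := by omega
  have hpl := initseg_len (fun x hx => (hgood x hx).1) k1 hlp' (by omega)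
  refine ⟨C0, ⟨s2, C0.u + (flat β1).length, C0.l - L * J⟩, hiC0, k2, h.toFin (hiC0.trans k2), ?_, hC0,
    by simp only; omega, hC0P, by simp only; rw [hEq]; exact hEP⟩
  rw [hpl] at k4
  exact k4

end ru
end PWKaux

namespace PWKaux

section asm
variable {S A : Type} {F : Sys S A} {T T' : ℤ → A} {init fin : Cfg S} {Pp : ℤ → Prop}

lemma Stp.transfer {a b : Cfg S} (h : Stp F T a b) (hu : T' a.u = T a.u) (hl : T' a.l = T a.l) :
    Stp F T' a b := by
  obtain ⟨d1, d2, h1, h2, h3⟩ := h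
  exact ⟨d1, d2, by rw [hu, hl]; exact h1, h2, h3⟩

lemma Reach.transfer {a b : Cfg S} {g0 g1 : ℤ} (h : Reach F T a b)
    (hout : ∀ z, z < g0 ∨ g1 ≤ z → T' z = T z)
    (hu : b.u < g0 ∨ g1 ≤ a.u) (hl : a.l < g0 ∨ g1 ≤ b.l) : Reach F T' a b := by
  induction h with
  | refl => exact .refl
  | @tail c d hc hs ih =>
    have m1 := hs.mono
    have m2 := Reach.mono hc
    refine (ih (by omega) (by omega)).tail (hs.transfer (hout _ (by omega)) (hout _ (by omega)))

lemma ASM {p g0 g1 : ℤ} (h : Scene F T init fin (fun z => z ≤ p))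
    (hout : ∀ z, z < g0 ∨ g1 ≤ z → T' z = T z) (h01 : g0 < g1) (hg1 : g1 ≤ p + 1)
    (hil : p < init.l)
    (hU : Win F T T' init fin g0 g1 (fun z => z ≤ p))
    (hL : Win (mF F) (mT T) (mT T') (mc init) (mc fin) (1 - g1) (1 - g0) (fun z => -z ≤ p)) :
    Reach F T' init fin := by
  rcases hU with hU | ⟨a, d, a1, a2, a3, a4, a5, a6, a7, a8⟩
  · rcases hL with hL | ⟨a', d', b1, b2, b3, b4, b5, b6, b7, b8⟩
    · simp only [mc_u] at hL
      exact Reach.transfer h.reach hout (Or.inl hU) (Or.inr (by omega))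
    · exfalso
      have b1 := Reach.mirror' b1
      have b2 := Reach.mirror' b2
      have b3 := Reach.mirror' b3
      simp only [mc_mc] at b1 b3
      have := h.never (mc a') b1
      have m1 := Reach.mono (b2.trans b3)
      simp only [mc_u, mc_l] at *
      omega
  · have n1 := h.never a a1 a7
    have n2 := h.never d (a1.trans a2) a8
    simp only [not_le] at n1 n2
    have s1 : Reach F T' init a := Reach.transfer a1 hout (Or.inl a5) (Or.inr (by omega))
    refine s1.trans (a4.trans ?_)
    rcases hL with hL | ⟨a', d', b1, b2, b3, b4, b5, b6, b7, b8⟩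
    · simp only [mc_u] at hL
      exact Reach.transfer a3 hout (Or.inr a6) (Or.inr (by omega))
    · have b1 := Reach.mirror' b1
      have b2 := Reach.mirror' b2
      have b3 := Reach.mirror' b3
      have b4 := Reach.mirror' b4
      simp only [mc_mc] at b1 b3
      have n3 := h.never (mc a') b1
      simp only [mc_u, mc_l] at n3
      have hda : Reach F T d (mc a') := Reach.ord_u (a1.trans a2) b1 (by simp only [mc_u]; omega)
      have m2 := Reach.mono b2
      simp only [mc_u, mc_l] at m2
      refine (Reach.transfer hda hout (Or.inr a6) (Or.inr (by simp only [mc_l]; omega))).trans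
        (b4.trans ?_)
      exact Reach.transfer b3 hout (Or.inr (by simp only [mc_u]; omega))
        (Or.inl (by simp only [mc_l]; omega))

def PassOK (F : Sys S A) (T : ℤ → A) (init fin : Cfg S) (Pp : ℤ → Prop) (G0 G1 : ℤ) (b : A)
    (K : ℕ) : Prop :=
  ∀ T' g0 g1, ZW T T' b K g0 g1 → G0 < g0 → g1 < G1 →
    (∀ s s', Arr F T init (g0 + 1) s → Arr F T init (g1 - K) s' → s = s') →
    Win F T T' init fin g0 g1 Pp

open Nat in
lemma passQ [Fintype S] (h : Scene F T init fin Pp) {G0 G1 : ℤ} {b : A} {K : ℕ}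
    (hi : init.u < G0) (hf : fin.u < G0 ∨ G1 ≤ fin.u)
    (hP : ∀ z, G0 ≤ z → z < G1 → Pp z) (hq : ¬ NQ F T init G0 G1)
    (hK1 : Fintype.card S ≤ K) (hK2 : (Fintype.card S)! * (Fintype.card S)! ∣ K) :
    PassOK F T init fin Pp G0 G1 b K := fun T' g0 g1 hz h0 h1 harr =>
  WQ h hi h0 h1 hf hP hq hz hK1 (dvd_of_mul_right_dvd hK2) harr

open Nat in
lemma passR [Fintype S] (h : Scene F T init fin Pp) {C L : ℕ} (hC : HC F C) {q0 : ℤ}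
    {G0 G1 G0' G1' G0'' G1'' : ℤ} {b : A} {K : ℕ}
    (hgi : ∀ z, ¬ Pp z → ¬ Pp (z - 1) → T z ≠ T (z - 1) → ∃ i : ℤ, z - 1 = q0 + L * i)
    (hP : ∀ z, G0' ≤ z → z < G1'' → Pp z)
    (hq1 : NQ F T init G0' G1') (h1 : G1' ≤ G0) (hq2 : NQ F T init G0'' G1'') (h2 : G1 ≤ G0'')
    (hL : C * (G1'' - G0') + Fintype.card S < L)
    (hK1 : Fintype.card S ≤ K) (hK2 : (Fintype.card S)! * (Fintype.card S)! ∣ K) :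
    PassOK F T init fin Pp G0 G1 b K := by
  intro T' g0 g1 hz e0 e1 _
  obtain ⟨c0, C0, a1, a2, a3, a4, a5⟩ := hq1
  obtain ⟨B, E, b1, b2, b3, b4, b5⟩ := hq2
  have m1 := a2.mono
  have m2 := b2.mono
  have hgg : g0 < g1 := by
    obtain ⟨v, hv, _⟩ := hz
    omega
  have hle : (C:ℤ) * (G1'' - C0.u) ≤ C * (G1'' - G0') :=
    mul_le_mul_of_nonneg_left (by omega) (by positivity)
  exact RU (pe := G1'') h hC hgi hz (fun z _ _ => hP z (by omega) (by omega)) hK1 hK2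
    a1 a2 a5 (by omega) (hP _ (by omega) (by omega)) (hP _ (by omega) (by omega))
    b1 b2 b5 (by omega) (hP _ (by omega) (by omega)) (hP _ (by omega) (by omega)) (by omega)
    (by omega)

lemma GROUP [Fintype S] {p G0 G1 : ℤ} (h : Scene F T init fin (fun z => z ≤ p)) {b : A} {K M : ℕ}
    (hG1 : G1 ≤ p + 1) (hil : p < init.l) (hfu : fin.u < G0 ∨ G1 ≤ fin.u)
    (hfl : fin.l < G0 ∨ G1 ≤ fin.l) (hM : Fintype.card S * Fintype.card S < M) (pos : Fin M → ℤ)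
    (hpos0 : ∀ τ, G0 < pos τ) (hpos1 : ∀ τ, pos τ + (K + 1) < G1)
    (hsp : ∀ τ τ', τ ≠ τ' → pos τ + (K + 1) ≤ pos τ' ∨ pos τ' + (K + 1) ≤ pos τ)
    (hPU : PassOK F T init fin (fun z => z ≤ p) G0 G1 b K)
    (hPL : PassOK (mF F) (mT T) (mc init) (mc fin) (fun z => -z ≤ p) (1 - G1) (1 - G0) b K) :
    ∃ τ τ', pos τ + (K + 1) ≤ pos τ' ∧ ∀ T', ZW T T' b K (pos τ) (pos τ' + (K + 1)) →
      Reach F T' init fin ∧ ∀ d, ¬ Stp F T' fin d := by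
  classical
  have hex : ∀ (F : Sys S A) (T : ℤ → A) (init : Cfg S) (x : ℤ),
      ∃ r : S, ∀ s, Arr F T init x s → r = s := by
    intro F T init x
    by_cases hh : ∃ s, Arr F T init x s
    · obtain ⟨s, hs⟩ := hh
      exact ⟨s, fun s' hs' => hs.det hs'⟩
    · exact ⟨init.s, fun s hs => absurd ⟨s, hs⟩ hh⟩
  choose f hf using hex F T init
  choose g hg using hex (mF F) (mT T) (mc init)
  obtain ⟨a, c, hac, he⟩ := Fintype.exists_ne_map_eq_of_card_lt
    (fun τ : Fin M => (f (pos τ + 1), g (1 - pos τ - K))) (by simpa using hM)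
  simp only [Prod.mk.injEq] at he
  obtain ⟨he1, he2⟩ := he
  wlog hlt : pos a + (K + 1) ≤ pos c generalizing a c
  · exact this c a hac.symm he1.symm he2.symm ((hsp a c hac).resolve_left hlt)
  refine ⟨a, c, hlt, fun T' hz => ?_⟩
  have ha0 := hpos0 a
  have hc1 := hpos1 c
  have hout := hz
  obtain ⟨_, _, _, _, hout⟩ := hout
  constructor
  · refine ASM h hout (by omega) (by omega) hil ?_ ?_
    · apply hPU _ _ _ hz (by omega) (by omega)
      intro s s' hs hs'
      rw [← hf _ _ hs, ← hf _ _ hs', he1]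
      congr 1; omega
    · apply hPL _ _ _ hz.mirror (by omega) (by omega)
      intro s s' hs hs'
      rw [← hg _ _ hs, ← hg _ _ hs']
      have e1 : 1 - (pos c + ((K:ℤ) + 1)) + 1 = 1 - pos c - K := by ring
      rw [e1, he2]
  · intro d hd
    refine h.halt d (hd.transfer (hout _ ?_).symm (hout _ ?_).symm)
    · omega
    · omega

lemma avoid {ι : Type} [Fintype ι] {n : ℕ} (Q : ι → Fin n → Prop)
    (hQ : ∀ i γ γ', Q i γ → Q i γ' → γ = γ') (hn : Fintype.card ι < n) : ∃ γ, ∀ i, ¬ Q i γ := by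
  by_contra hcon
  push Not at hcon
  choose g hg using hcon
  have hinj : Function.Injective g := by
    intro a b hab
    exact hQ (g a) a b (hg a) (by rw [hab]; exact hg b)
  have := Fintype.card_le_of_injective g hinj
  simp at this; omega

end asm
end PWKaux

namespace PWKaux

section cases
variable {S A : Type} {F : Sys S A} {T : ℤ → A} {init fin : Cfg S}

lemma grp_unique {Gs : ℕ → ℤ} (hG : Monotone Gs) {a b : ℕ} {x : ℤ} (h1 : Gs a ≤ x)
    (h2 : x < Gs (a + 1)) (h3 : Gs b ≤ x) (h4 : x < Gs (b + 1)) : a = b := by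
  by_contra hne
  rcases Nat.lt_or_gt_of_ne hne with h | h
  · have := hG (show a + 1 ≤ b by omega)
    omega
  · have := hG (show b + 1 ≤ a by omega)
    omega

/-- the test positions inside the groups -/
structure Tests (T : ℤ → A) (Gs : ℕ → ℤ) (n M K : ℕ) (pos : ℕ → Fin M → ℤ) : Prop where
  mono : Monotone Gs
  pos0 : ∀ γ < n, ∀ τ, Gs γ < pos γ τ
  pos1 : ∀ γ < n, ∀ τ, pos γ τ + (K + 1) < Gs (γ + 1)
  sp : ∀ γ < n, ∀ τ τ', τ ≠ τ' → pos γ τ + (K + 1) ≤ pos γ τ' ∨ pos γ τ' + (K + 1) ≤ pos γ τ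

open Nat in
lemma caseA [Fintype S] {p : ℤ} (h : Scene F T init fin (fun z => z ≤ p)) {C L K M : ℕ} {b : A}
    (hC : HC F C) (hC' : HC (mF F) C)
    (hgi : ∀ x, p < x → T x ≠ T (x + 1) → ∃ i : ℤ, x = p + L * i)
    {Gs : ℕ → ℤ} {pos : ℕ → Fin M → ℤ} (ht : Tests T Gs 7 M K pos)
    (hi : init.u < Gs 0) (hG7 : Gs 7 ≤ p + 1) (hil : p < init.l)
    (hL : C * (Gs 7 - Gs 0) + Fintype.card S < L)
    (hK1 : Fintype.card S ≤ K) (hK2 : (Fintype.card S)! * (Fintype.card S)! ∣ K)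
    (hM : Fintype.card S * Fintype.card S < M) :
    ∃ γ < 7, ∃ τ τ', pos γ τ + (K + 1) ≤ pos γ τ' ∧
      ∀ T', ZW T T' b K (pos γ τ) (pos γ τ' + (K + 1)) →
      Reach F T' init fin ∧ ∀ d, ¬ Stp F T' fin d := by
  set NU : ℕ → Prop := fun γ => NQ F T init (Gs γ) (Gs (γ + 1)) with hNU
  set NL : ℕ → Prop := fun γ => NQ (mF F) (mT T) (mc init) (1 - Gs (γ + 1)) (1 - Gs γ) with hNL
  obtain ⟨γ, hγ⟩ := avoid (ι := Fin 6) (n := 7) (fun i γ => match i with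
    | 0 => NU γ ∧ ∀ γ' : Fin 7, γ' < γ → ¬ NU γ'
    | 1 => NU γ ∧ ∀ γ' : Fin 7, γ < γ' → ¬ NU γ'
    | 2 => NL γ ∧ ∀ γ' : Fin 7, γ' < γ → ¬ NL γ'
    | 3 => NL γ ∧ ∀ γ' : Fin 7, γ < γ' → ¬ NL γ'
    | 4 => Gs γ ≤ fin.u ∧ fin.u < Gs (γ + 1)
    | 5 => Gs γ ≤ fin.l ∧ fin.l < Gs (γ + 1)) (by
      have key1 : ∀ (N : ℕ → Prop) (γ γ' : Fin 7), (N γ ∧ ∀ a : Fin 7, a < γ → ¬ N a) →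
          (N γ' ∧ ∀ a : Fin 7, a < γ' → ¬ N a) → γ = γ' := by
        intro N γ γ' h1 h2
        rcases lt_trichotomy γ γ' with h | h | h
        · exact absurd h1.1 (h2.2 _ h)
        · exact h
        · exact absurd h2.1 (h1.2 _ h)
      have key2 : ∀ (N : ℕ → Prop) (γ γ' : Fin 7), (N γ ∧ ∀ a : Fin 7, γ < a → ¬ N a) →
          (N γ' ∧ ∀ a : Fin 7, γ' < a → ¬ N a) → γ = γ' := by
        intro N γ γ' h1 h2
        rcases lt_trichotomy γ γ' with h | h | h
        · exact absurd h2.1 (h1.2 _ h)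
        · exact h
        · exact absurd h1.1 (h2.2 _ h)
      intro i γ γ' h1 h2
      fin_cases i
      · exact key1 NU γ γ' h1 h2
      · exact key2 NU γ γ' h1 h2
      · exact key1 NL γ γ' h1 h2
      · exact key2 NL γ γ' h1 h2
      · exact Fin.ext (grp_unique ht.mono h1.1 h1.2 h2.1 h2.2)
      · exact Fin.ext (grp_unique ht.mono h1.1 h1.2 h2.1 h2.2)) (by simp)
  have q0 := hγ 0
  have q1 := hγ 1
  have q2 := hγ 2
  have q3 := hγ 3
  have q4 := hγ 4
  have q5 := hγ 5
  simp only at q0 q1 q2 q3 q4 q5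
  have m0 := ht.mono (Nat.zero_le γ)
  have m7 := ht.mono (show (γ : ℕ) + 1 ≤ 7 by omega)
  have mγ := ht.mono (show (γ : ℕ) ≤ γ + 1 by omega)
  have hfu : fin.u < Gs γ ∨ Gs (γ + 1) ≤ fin.u := by
    by_contra hcon; exact q4 ⟨by omega, by omega⟩
  have hfl : fin.l < Gs γ ∨ Gs (γ + 1) ≤ fin.l := by
    by_contra hcon; exact q5 ⟨by omega, by omega⟩
  have hLle : ∀ a b : Fin 7, (C:ℤ) * (Gs (b + 1) - Gs a) + Fintype.card S < L := by
    intro a b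
    have n0 := ht.mono (Nat.zero_le a)
    have n7 := ht.mono (show (b : ℕ) + 1 ≤ 7 by omega)
    have : (C:ℤ) * (Gs (b + 1) - Gs a) ≤ C * (Gs 7 - Gs 0) :=
      mul_le_mul_of_nonneg_left (by omega) (by positivity)
    omega
  have hPU : PassOK F T init fin (fun z => z ≤ p) (Gs γ) (Gs (γ + 1)) b K := by
    by_cases hq : NU γ
    · simp only [hq, true_and, not_forall, not_not] at q0 q1
      obtain ⟨γ1, l1, hq1⟩ := q0
      obtain ⟨γ2, l2, hq2⟩ := q1
      have k7 := ht.mono (show (γ2 : ℕ) + 1 ≤ 7 by omega)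
      refine passR (q0 := p) h hC ?_ ?_ hq1 (ht.mono ?_) hq2 (ht.mono ?_) (hLle _ _) hK1 hK2
      · intro z z1 z2 z3
        simp only [not_le] at z1 z2
        obtain ⟨i, hi⟩ := hgi (z - 1) z2 (by rw [sub_add_cancel]; exact z3.symm)
        exact ⟨i, hi⟩
      · intro z _ hz; omega
      · exact l1
      · exact l2
    · exact passQ h (by omega) hfu (fun z _ hz => by omega) hq hK1 hK2
  have hPL : PassOK (mF F) (mT T) (mc init) (mc fin) (fun z => -z ≤ p) (1 - Gs (γ + 1)) (1 - Gs γ)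
      b K := by
    by_cases hq : NL γ
    · simp only [hq, true_and, not_forall, not_not] at q2 q3
      obtain ⟨γ1, l1, hq1⟩ := q2
      obtain ⟨γ2, l2, hq2⟩ := q3
      have n1 := ht.mono (show (γ1 : ℕ) + 1 ≤ γ from l1)
      have n2 := ht.mono (show (γ : ℕ) + 1 ≤ γ2 from l2)
      have k7 := ht.mono (show (γ2 : ℕ) + 1 ≤ 7 by omega)
      refine passR (q0 := -(p+1)) (L := L) h.mirror hC' ?_ ?_ hq2 (by omega) hq1 (by omega) ?_ hK1 hK2
      · intro z z1 z2 z3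
        simp only [not_le] at z1 z2
        obtain ⟨i, hi⟩ := hgi (-z) z1 (by
          simp only [mT] at z3
          rwa [show -z + 1 = -(z - 1) by ring])
        exact ⟨-i, by linarith⟩
      · intro z hz _; omega
      · have := hLle γ1 γ2
        convert this using 3
        ring
    · exact passQ h.mirror (by simp only [mc_u]; omega) (by simp only [mc_u]; omega)
        (fun z hz _ => by omega) hq hK1 hK2
  obtain ⟨τ, τ', r1, r2⟩ := GROUP h (by omega) hil hfu hfl hM (pos γ) (ht.pos0 γ γ.2) (ht.pos1 γ γ.2)
    (ht.sp γ γ.2) hPU hPL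
  exact ⟨γ, γ.2, τ, τ', r1, r2⟩

lemma leave_unique {c d c' d' : Cfg S} (h1 : Reach F T init c) (h2 : Stp F T c d)
    (h3 : T c.l ≠ T d.l) (g1 : Reach F T init c') (g2 : Stp F T c' d') (g3 : T c'.l ≠ T d'.l)
    (he : c.l = c'.l) : c = c' := by
  have key : ∀ c d c' : Cfg S, Stp F T c d → T c.l ≠ T d.l → c.l = c'.l → Reach F T c c' → c = c' := by
    intro c d c' h2 h3 he h
    rcases h.cases_head with h | ⟨x, hx, h⟩
    · exact h
    · exfalso
      have := hx.det h2
      subst this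
      have m1 := Reach.mono h
      have m2 := h2.mono
      have : c.l = x.l := by omega
      rw [this] at h3; exact h3 rfl
  rcases Reach.total h1 g1 with h | h
  · exact key _ _ _ h2 h3 he h
  · exact (key _ _ _ g2 g3 he.symm h).symm

open Nat in
lemma caseB [Fintype S] {p : ℤ} (h : Scene F T init fin (fun z => z ≤ p)) {K M V n : ℕ} {b : A}
    {Gs : ℕ → ℤ} {pos : ℕ → Fin M → ℤ} (ht : Tests T Gs n M K pos)
    (hi : init.u < Gs 0) (hGn : Gs n ≤ p + 1) (hil : p < init.l)
    (hV : ∀ c, Reach F T init c → c.u ≤ p + V ∧ c.l ≤ p + V) (hn : 2 * V + 2 < n)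
    (hK1 : Fintype.card S ≤ K) (hK2 : (Fintype.card S)! * (Fintype.card S)! ∣ K)
    (hM : Fintype.card S * Fintype.card S < M) :
    ∃ γ < n, ∃ τ τ', pos γ τ + (K + 1) ≤ pos γ τ' ∧
      ∀ T', ZW T T' b K (pos γ τ) (pos γ τ' + (K + 1)) →
      Reach F T' init fin ∧ ∀ d, ¬ Stp F T' fin d := by
  obtain ⟨γ, hγ⟩ := avoid (ι := (Fin V ⊕ Fin V) ⊕ Bool) (n := n) (fun i γ => match i with
    | .inl (.inl v) => ∃ c d, Reach F T init c ∧ Stp F T c d ∧ Gs γ ≤ c.u ∧ d.u < Gs (γ + 1) ∧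
        T c.l ≠ T d.l ∧ c.l = p + 1 + (v : ℕ)
    | .inl (.inr v) => ∃ c d, Reach (mF F) (mT T) (mc init) c ∧ Stp (mF F) (mT T) c d ∧
        1 - Gs (γ + 1) ≤ c.u ∧ d.u < 1 - Gs γ ∧ mT T c.l ≠ mT T d.l ∧ c.l = - (p + 1 + (v : ℕ))
    | .inr true => Gs γ ≤ fin.u ∧ fin.u < Gs (γ + 1)
    | .inr false => Gs γ ≤ fin.l ∧ fin.l < Gs (γ + 1)) (by
      intro i γ γ' h1 h2
      rcases i with (i | i) | i | i
      · obtain ⟨c, d, a1, a2, a3, a4, a5, a6⟩ := h1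
        obtain ⟨c', d', b1, b2, b3, b4, b5, b6⟩ := h2
        have := leave_unique a1 a2 a5 b1 b2 b5 (by omega)
        subst this
        have m1 := a2.mono
        have m2 := b2.mono
        exact Fin.ext (grp_unique (x := c.u) ht.mono a3 (by omega) b3 (by omega))
      · obtain ⟨c, d, a1, a2, a3, a4, a5, a6⟩ := h1
        obtain ⟨c', d', b1, b2, b3, b4, b5, b6⟩ := h2
        have := leave_unique a1 a2 a5 b1 b2 b5 (by omega)
        subst this
        have m1 := a2.mono
        have m2 := b2.mono
        exact Fin.ext (grp_unique (x := -c.u) ht.mono (by omega) (by omega) (by omega) (by omega))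
      · exact Fin.ext (grp_unique ht.mono h1.1 h1.2 h2.1 h2.2)
      · exact Fin.ext (grp_unique ht.mono h1.1 h1.2 h2.1 h2.2)) (by simp; omega)
  have m0 := ht.mono (Nat.zero_le γ)
  have m7 := ht.mono (show (γ : ℕ) + 1 ≤ n by omega)
  have hfu : fin.u < Gs γ ∨ Gs (γ + 1) ≤ fin.u := by
    by_contra hcon; exact hγ (.inr true) ⟨by omega, by omega⟩
  have hfl : fin.l < Gs γ ∨ Gs (γ + 1) ≤ fin.l := by
    by_contra hcon; exact hγ (.inr false) ⟨by omega, by omega⟩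
  have hPU : PassOK F T init fin (fun z => z ≤ p) (Gs γ) (Gs (γ + 1)) b K := by
    refine passQ h (by omega) hfu (fun z _ hz => by omega) ?_ hK1 hK2
    rintro ⟨c, d, a1, a2, a3, a4, a5⟩
    have m := a2.mono
    have n1 := h.never c a1 (by omega)
    have n2 := (hV c a1).2
    simp only [not_le] at n1
    refine hγ (.inl (.inl ⟨(c.l - (p + 1)).toNat, by omega⟩)) ⟨c, d, a1, a2, a3, a4, a5, ?_⟩
    simp only; omega
  have hPL : PassOK (mF F) (mT T) (mc init) (mc fin) (fun z => -z ≤ p) (1 - Gs (γ + 1)) (1 - Gs γ)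
      b K := by
    refine passQ h.mirror (by simp only [mc_u]; omega) (by simp only [mc_u]; omega)
        (fun z hz _ => by omega) ?_ hK1 hK2
    rintro ⟨c, d, a1, a2, a3, a4, a5⟩
    have m := a2.mono
    have n1 := h.mirror.never c a1 (by omega)
    have n2 := (hV (mc c) (by simpa using Reach.mirror' a1)).1
    simp only [not_le, mc_u] at n1 n2
    refine hγ (.inl (.inr ⟨(-c.l - (p + 1)).toNat, by omega⟩)) ⟨c, d, a1, a2, a3, a4, a5, ?_⟩
    simp only; omega
  obtain ⟨τ, τ', r1, r2⟩ := GROUP h (by omega) hil hfu hfl hM (pos γ) (ht.pos0 γ γ.2) (ht.pos1 γ γ.2)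
    (ht.sp γ γ.2) hPU hPL
  exact ⟨γ, γ.2, τ, τ', r1, r2⟩

end cases
end PWKaux

namespace PWKaux
open WK

section words

/-- `m` units `b^k a^k` (`b = true`) -/
def un (k : ℕ) : ℕ → List Bool
  | 0 => []
  | m + 1 => List.replicate k true ++ List.replicate k false ++ un k m

lemma un_length (k m : ℕ) : (un k m).length = 2 * k * m := by
  induction m with
  | zero => rfl
  | succ m ih => simp [un, ih]; ring

lemma un_add (k m n : ℕ) : un k (m + n) = un k m ++ un k n := by
  induction m with
  | zero => simp [un]
  | succ m ih => rw [show m + 1 + n = (m + n) + 1 by ring]; simp [un, ih]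

lemma un_get (k m t : ℕ) (ht : t < 2 * k * m) : (un k m)[t]? = some ((t / k) % 2 == 0) := by
  induction m generalizing t with
  | zero => simp at ht
  | succ m ih =>
    have hk : 0 < k := by
      rcases k with _ | k
      · simp at ht
      · omega
    rw [un]
    by_cases h1 : t < k
    · rw [List.append_assoc, List.getElem?_append_left (by simpa using h1)]
      simp [h1, Nat.div_eq_of_lt h1]
    by_cases h2 : t < 2 * k
    · rw [List.getElem?_append_left (by simp; omega), List.getElem?_append_right (by simp; omega)]
      have : t / k = 1 := by
        rw [Nat.div_eq_iff hk]; omega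
      have h3 : t - k < k := by omega
      simp [this, h3]
    · rw [List.getElem?_append_right (by simp; omega)]
      simp only [List.length_append, List.length_replicate]
      rw [ih (t - (k + k)) (by rw [mul_add] at ht; omega)]
      obtain ⟨r, rfl⟩ : ∃ r, t = r + k * 2 := ⟨t - k * 2, by omega⟩
      rw [show r + k * 2 - (k + k) = r by omega, Nat.add_mul_div_left _ _ hk]
      simp

/-- the tape as a function on the integers -/
def Tz (w : List Bool) : ℤ → TSym Bool := fun k => if k < 0 then Sum.inr false else tape w k.toNat

lemma tape_succ (w : List Bool) (t : ℕ) :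
    tape w (t + 1) = (w[t]?.map Sum.inl).getD (Sum.inr true) := by
  simp only [tape, List.cons_append, List.getD_cons_succ]
  rw [List.getD_eq_getElem?_getD]
  by_cases h : t < w.length
  · rw [List.getElem?_append_left (by simpa using h)]; simp
  · rw [List.getElem?_append_right (by simpa using h)]
    rw [List.getElem?_eq_none (l := w) (by omega)]
    rcases hh : (t - (w.map (Sum.inl (β := Bool))).length) with _ | n <;> simp

lemma Tz_succ (w : List Bool) (t : ℕ) :
    Tz w (1 + t) = (w[t]?.map Sum.inl).getD (Sum.inr true) := by
  rw [← tape_succ, Tz, if_neg (by omega)]; congr 1; omega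

lemma Tz_nat (w : List Bool) (t : ℕ) : Tz w t = tape w t := by
  rw [Tz, if_neg (by omega)]; rfl

lemma Rd_Tz (u v r : List Bool) : Rd (Tz (u ++ v ++ r)) (1 + u.length) (v.map Sum.inl) := by
  rw [Rd_iff]
  intro k x hk
  simp only [List.getElem?_map, Option.map_eq_some_iff] at hk
  obtain ⟨a, ha, rfl⟩ := hk
  have hlt := (List.getElem?_eq_some_iff.1 ha).1
  rw [add_assoc, ← Nat.cast_add, Tz_succ, List.append_assoc,
    List.getElem?_append_right (by omega), List.getElem?_append_left (by omega)]
  simp [ha]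

lemma Tz_agree (u v v' r : List Bool) (hl : v'.length = v.length) (z : ℤ)
    (hz : z < 1 + u.length ∨ 1 + (u.length : ℤ) + v.length ≤ z) :
    Tz (u ++ v' ++ r) z = Tz (u ++ v ++ r) z := by
  by_cases h0 : z < 1
  · by_cases h1 : z < 0
    · simp [Tz, h1]
    · have : z = 0 := by omega
      subst this
      simp [Tz, tape]
  · obtain ⟨t, rfl⟩ : ∃ t : ℕ, z = 1 + t := ⟨(z - 1).toNat, by omega⟩
    rw [Tz_succ, Tz_succ]
    congr 2
    rcases hz with hz | hz
    · rw [List.append_assoc, List.append_assoc, List.getElem?_append_left (by omega),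
        List.getElem?_append_left (by omega)]
    · rw [List.getElem?_append_right (by simp; omega), List.getElem?_append_right (by simp; omega)]
      simp [hl]

lemma ZWun (pre suf : List Bool) (K j j' m : ℕ) (h1 : j < j') (h2 : j' < m) :
    ∃ w' rest : List Bool, ZW (Tz (pre ++ un (K+1) m ++ suf)) (Tz w') (Sum.inl true) K
      (1 + pre.length + 2 * (K + 1) * j) (1 + pre.length + 2 * (K + 1) * j' + (K + 1)) ∧
      w'.length = (pre ++ un (K+1) m ++ suf).length ∧
      w' = pre ++ un (K+1) j ++ true :: false :: rest := by
  obtain ⟨a, rfl⟩ : ∃ a, j' = j + (a + 1) := ⟨j' - j - 1, by omega⟩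
  obtain ⟨c, rfl⟩ : ∃ c, m = j + (a + 1) + (c + 1) := ⟨m - (j + (a+1)) - 1, by omega⟩
  set v : List Bool := List.replicate (K+1) false ++ un (K+1) a with hv
  set r : List Bool := List.replicate (K+1) false ++ un (K+1) c ++ suf with hr
  set z : List Bool := List.replicate (K+1) true ++ v ++ List.replicate (K+1) true with hz
  set z' : List Bool := [true] ++ v ++ List.replicate (2*K+1) true with hz'
  have hw : pre ++ un (K+1) (j + (a + 1) + (c + 1)) ++ suf = (pre ++ un (K+1) j) ++ z ++ r := by
    rw [un_add, un_add, hz, hr, hv, un, un]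
    simp only [List.append_assoc]
  have hu : (((pre ++ un (K+1) j).length : ℕ) : ℤ) = pre.length + 2 * (K + 1) * j := by
    rw [List.length_append, un_length]; push_cast; ring
  have hvl : v.length = (K + 1) + 2 * (K+1) * a := by simp [hv, un_length]
  have hzl : z.length = 2 * (K + 1) + v.length := by simp [hz]; ring
  have hzl' : z'.length = z.length := by rw [hzl]; simp [hz']; ring
  refine ⟨(pre ++ un (K+1) j) ++ z' ++ r, List.replicate K false ++ un (K+1) a ++
    List.replicate (2*K+1) true ++ r, ?_, ?_, ?_⟩
  · rw [hw]
    refine ⟨v.map Sum.inl, ?_, ?_, Or.inl ?_, ?_⟩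
    · rw [List.length_map, hvl]; push_cast; ring
    · have := Rd_Tz (pre ++ un (K+1) j) z r
      rw [hu, hz] at this
      simp only [List.map_append, List.map_replicate] at this
      convert this using 1
      ring
    · have := Rd_Tz (pre ++ un (K+1) j) z' r
      rw [hu, hz'] at this
      simp only [List.map_append, List.map_replicate, List.map_cons, List.map_nil] at this
      convert this using 1
      ring
    · intro x hx
      apply Tz_agree _ _ _ _ hzl'
      rw [hzl, hvl, hu]
      push_cast at hx ⊢
      rcases hx with hx | hx
      · left; linarith
      · right; linarith
  · rw [hw]; simp only [List.length_append, hzl']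
  · simp [hz', hv, List.replicate_succ]

lemma giant (X : List Bool) (L m : ℕ) (x : ℤ) (hx : (X.length : ℤ) < x)
    (hne : Tz (X ++ un L m) x ≠ Tz (X ++ un L m) (x + 1)) :
    ∃ i : ℤ, x = X.length + L * i := by
  obtain ⟨t, rfl⟩ : ∃ t : ℕ, x = X.length + 1 + t := ⟨(x - (X.length + 1)).toNat, by omega⟩
  have key : ∀ t : ℕ, Tz (X ++ un L m) (X.length + 1 + t) =
      ((un L m)[t]?.map Sum.inl).getD (Sum.inr true) := by
    intro t
    rw [show (X.length : ℤ) + 1 + t = 1 + ((X.length + t : ℕ) : ℤ) by push_cast; ring, Tz_succ,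
      List.getElem?_append_right (by omega)]
    simp
  suffices L ∣ t + 1 by
    obtain ⟨i, hi⟩ := this
    refine ⟨i, ?_⟩
    have : (t : ℤ) + 1 = L * i := by exact_mod_cast hi
    omega
  rw [key, show (X.length : ℤ) + 1 + t + 1 = X.length + 1 + ((t + 1 : ℕ) : ℤ) by push_cast; ring,
    key] at hne
  by_contra hd
  apply hne
  by_cases h1 : t + 1 < 2 * L * m
  · rw [un_get _ _ _ h1, un_get _ _ _ (by omega), Nat.succ_div, if_neg hd, add_zero]
  · by_cases h2 : t + 1 = 2 * L * m
    · exact absurd ⟨2 * m, by rw [h2]; ring⟩ hd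
    · rw [List.getElem?_eq_none (by rw [un_length]; omega),
        List.getElem?_eq_none (by rw [un_length]; omega)]

end words
end PWKaux

namespace PWKaux
open WK

section bridge
variable (A : DPWK Bool)

open Classical in
/-- the abstract two-head system of a Watson-Crick system -/
noncomputable def FA : Sys (A.Q1 × A.Q2) (TSym Bool) := fun s x y =>
  match A.δ1 s.1 x (A.μ2 s.2 y), A.δ2 s.2 y (A.μ1 s.1 x) with
  | some (p', d1), some (q', d2) =>
    if y = Sum.inr false ∧ d2 = true then none else some ((p', q'), d1, d2)
  | _, _ => none

variable {A}

lemma FA_iff {s t : A.Q1 × A.Q2} {x y : TSym Bool} {d1 d2 : Bool} :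
    FA A s x y = some (t, d1, d2) ↔ A.δ1 s.1 x (A.μ2 s.2 y) = some (t.1, d1) ∧
      A.δ2 s.2 y (A.μ1 s.1 x) = some (t.2, d2) ∧ ¬ (y = Sum.inr false ∧ d2 = true) := by
  unfold FA
  obtain ⟨t1, t2⟩ := t
  rcases A.δ1 s.1 x (A.μ2 s.2 y) with _ | ⟨p', e1⟩
  · simp
  rcases A.δ2 s.2 y (A.μ1 s.1 x) with _ | ⟨q', e2⟩
  · simp
  simp only []
  split_ifs with h
  · constructor
    · simp
    · rintro ⟨h1, h2, h3⟩
      simp only [Option.some.injEq, Prod.mk.injEq] at h2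
      rw [← h2.2] at h3
      exact absurd h h3
  · simp only [Option.some.injEq, Prod.mk.injEq]
    constructor
    · rintro ⟨⟨rfl, rfl⟩, rfl, rfl⟩
      exact ⟨⟨rfl, rfl⟩, ⟨rfl, rfl⟩, h⟩
    · rintro ⟨⟨rfl, rfl⟩, ⟨rfl, rfl⟩, _⟩
      exact ⟨⟨rfl, rfl⟩, rfl, rfl⟩

def φ (c : Config A) : Cfg (A.Q1 × A.Q2) := ⟨(c.p, c.q), c.i, c.j⟩

lemma φ_inj {c d : Config A} (h : φ c = φ d) : c = d := by
  obtain ⟨p, i, q, j⟩ := c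
  obtain ⟨p', i', q', j'⟩ := d
  simp only [φ, Cfg.mk.injEq, Prod.mk.injEq, Nat.cast_inj] at h
  obtain ⟨⟨rfl, rfl⟩, rfl, rfl⟩ := h
  rfl

lemma tape_left (w : List Bool) (j : ℕ) : tape w j = Sum.inr false ↔ j = 0 := by
  rcases j with _ | j
  · simp [tape]
  · rw [tape_succ]
    rcases w[j]? with _ | b <;> simp

lemma stp_of_step {w : List Bool} {c d : Config A} (h : Step A w c d) :
    Stp (FA A) (Tz w) (φ c) (φ d) := by
  obtain ⟨d1, d2, h1, h2, h3, h4⟩ := h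
  refine ⟨d1, d2, ?_, ?_, ?_⟩
  · rw [FA_iff]
    simp only [φ, Tz_nat, tape_left]
    refine ⟨h1, h2, ?_⟩
    rintro ⟨hj, rfl⟩
    simp at h4; omega
  · cases d1 <;> simp [φ, h3]
  · cases d2 <;> simp [φ, h4]

lemma step_of_stp {w : List Bool} {c : Config A} {d : Cfg (A.Q1 × A.Q2)}
    (h : Stp (FA A) (Tz w) (φ c) d) : ∃ d', d = φ d' ∧ Step A w c d' := by
  obtain ⟨d1, d2, h1, h2, h3⟩ := h
  rw [FA_iff] at h1
  simp only [φ, Tz_nat, tape_left] at h1 h2 h3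
  obtain ⟨h4, h5, h6⟩ := h1
  have h7 : d2 = true → 0 < c.j := by
    intro h
    by_contra h8
    exact h6 ⟨by omega, h⟩
  refine ⟨⟨d.s.1, c.i + d1.toNat, d.s.2, c.j - d2.toNat⟩, ?_, d1, d2, h4, h5, ?_, ?_⟩
  · ext
    · rfl
    · rfl
    · simp [φ, h2]
    · simp only [φ, h3]
      cases d2
      · simp
      · have := h7 rfl
        simp; omega
  · cases d1 <;> rfl
  · cases d2
    · simp
    · have := h7 rfl
      simp; omega

lemma reach_φ {w : List Bool} {c : Config A} {d : Cfg (A.Q1 × A.Q2)}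
    (h : Reach (FA A) (Tz w) (φ c) d) : ∃ d', d = φ d' ∧ ReflTransGen (Step A w) c d' := by
  induction h with
  | refl => exact ⟨c, rfl, .refl⟩
  | tail _ hs ih =>
    obtain ⟨e, rfl, he⟩ := ih
    obtain ⟨d', rfl, hd⟩ := step_of_stp hs
    exact ⟨d', rfl, he.tail hd⟩

lemma reach_of {w : List Bool} {c d : Config A} (h : ReflTransGen (Step A w) c d) :
    Reach (FA A) (Tz w) (φ c) (φ d) := by
  induction h with
  | refl => exact .refl
  | tail _ hs ih => exact ih.tail (stp_of_step hs)

lemma halt_iff {w : List Bool} {c : Config A} :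
    Halted A w c ↔ ∀ d, ¬ Stp (FA A) (Tz w) (φ c) d := by
  constructor
  · intro h d hd
    obtain ⟨d', -, hd'⟩ := step_of_stp hd
    exact h ⟨d', hd'⟩
  · rintro h ⟨d, hd⟩
    exact h _ (stp_of_step hd)

lemma chain_of {X : Type} {r : X → X → Prop} {a b : X} (h : ReflTransGen r a b) :
    ∃ cs : List X, cs.head? = some a ∧ List.IsChain r cs ∧ cs.getLast? = some b := by
  induction h using ReflTransGen.head_induction_on with
  | refl => exact ⟨[b], by simp⟩
  | @head a c hs _ ih =>
    obtain ⟨cs, h1, h2, h3⟩ := ih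
    rcases cs with _ | ⟨x, cs⟩
    · simp at h1
    · simp only [List.head?_cons, Option.some.injEq] at h1
      subst h1
      refine ⟨a :: x :: cs, rfl, ?_, ?_⟩
      · simp [hs, h2]
      · rw [List.getLast?_cons_cons]; exact h3

lemma of_chain {X : Type} {r : X → X → Prop} {b : X} : ∀ (cs : List X) {a : X},
    cs.head? = some a → List.IsChain r cs → cs.getLast? = some b → ReflTransGen r a b
  | [], _, h1, _, _ => by simp at h1
  | [x], a, h1, _, h3 => by
    simp at h1 h3; subst h1 h3; exact .refl
  | x :: y :: cs, a, h1, h2, h3 => by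
    simp only [List.head?_cons, Option.some.injEq] at h1
    subst h1
    rw [List.getLast?_cons_cons] at h3
    simp only [List.isChain_cons_cons] at h2
    exact ReflTransGen.head h2.1 (of_chain (y :: cs) rfl h2.2 h3)

def ini (A : DPWK Bool) (w : List Bool) : Cfg (A.Q1 × A.Q2) := ⟨(A.q01, A.q02), 0, w.length + 1⟩

lemma acc_iff {w : List Bool} : Accepts A w ↔ ∃ fin, Reach (FA A) (Tz w) (ini A w) fin ∧
    (∀ d, ¬ Stp (FA A) (Tz w) fin d) ∧ (fin.s.1 ∈ A.F1 ∨ fin.s.2 ∈ A.F2) := by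
  have hi : ini A w = φ (initConf A w) := by simp [ini, φ, initConf]
  rw [hi]
  constructor
  · rintro ⟨cs, h1, h2, c, h3, h4, h5⟩
    exact ⟨φ c, reach_of (of_chain cs h1 h2 h3), halt_iff.1 h4, h5⟩
  · rintro ⟨fin, h1, h2, h3⟩
    obtain ⟨c, rfl, hc⟩ := reach_φ h1
    obtain ⟨cs, g1, g2, g3⟩ := chain_of hc
    exact ⟨cs, g1, g2, c, g3, halt_iff.2 h2, h3⟩

lemma reach_nonneg {w : List Bool} {c : Cfg (A.Q1 × A.Q2)} (h : Reach (FA A) (Tz w) (ini A w) c) :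
    0 ≤ c.u ∧ 0 ≤ c.l := by
  have hi : ini A w = φ (initConf A w) := by simp [ini, φ, initConf]
  rw [hi] at h
  obtain ⟨d, rfl, -⟩ := reach_φ h
  simp [φ]

lemma exists_pos (x y : TSym Bool) : ∃ (w : List Bool) (i j : ℕ), tape w i = x ∧ tape w j = y := by
  have key : ∀ (a b : Bool), ∀ z : TSym Bool, (z = Sum.inl a ∨ z = Sum.inl b ∨ ∃ c, z = Sum.inr c) →
      ∃ i, tape [a, b] i = z := by
    rintro a b z (rfl | rfl | ⟨c, rfl⟩)
    · exact ⟨1, rfl⟩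
    · exact ⟨2, rfl⟩
    · cases c
      · exact ⟨0, rfl⟩
      · exact ⟨3, rfl⟩
  refine ⟨[x.elim id id, y.elim id id], ?_⟩
  obtain ⟨i, hi⟩ := key (x.elim id id) (y.elim id id) x (by rcases x with x | x <;> simp)
  obtain ⟨j, hj⟩ := key (x.elim id id) (y.elim id id) y (by rcases y with x | x <;> simp)
  exact ⟨i, j, hi, hj⟩

lemma FA_inj (hA : Reversible A) : Inj (FA A) := by
  obtain ⟨W⟩ := hA
  intro s r x y t d1 d2 e1 e2 hs hr
  obtain ⟨w, i, j, rfl, rfl⟩ := exists_pos x y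
  have key : ∀ (s : A.Q1 × A.Q2) (d1 d2 : Bool), FA A s (tape w i) (tape w j) = some (t, d1, d2) →
      ∃ e1 e2, W.δ'1 t.1 (tape w i) (W.μ'2 t.2 (tape w j)) = some (s.1, e1) ∧
        W.δ'2 t.2 (tape w j) (W.μ'1 t.1 (tape w i)) = some (s.2, e2) := by
    intro s d1 d2 hs
    have hst : Stp (FA A) (Tz w) (φ (⟨s.1, i, s.2, j⟩ : Config A))
        ⟨t, i + (d1.toNat : ℤ), j - (d2.toNat : ℤ)⟩ := by
      refine ⟨d1, d2, ?_, rfl, rfl⟩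
      simp only [φ, Tz_nat]; exact hs
    obtain ⟨d, hd, hstep⟩ := step_of_stp hst
    have h1 : d.p = t.1 ∧ d.q = t.2 := by
      have := congrArg Cfg.s hd
      simp only [φ] at this
      rw [this]; simp
    obtain ⟨e1, e2, g1, g2, -⟩ := (W.inverse w _ _).2 hstep
    rw [h1.1, h1.2] at g1 g2
    exact ⟨e1, e2, g1, g2⟩
  obtain ⟨a1, a2, g1, g2⟩ := key s d1 d2 hs
  obtain ⟨b1, b2, k1, k2⟩ := key r e1 e2 hr
  rw [g1] at k1
  rw [g2] at k2
  simp only [Option.some.injEq, Prod.mk.injEq] at k1 k2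
  exact Prod.ext k1.1 k2.1

end bridge

section lang

/-- automaton for the words without isolated `b` -/
def Mdfa : DFA Bool (Fin 4) where
  step s x := match s, x with
    | 0, true => 1
    | 0, false => 0
    | 1, true => 2
    | 1, false => 3
    | 2, true => 2
    | 2, false => 0
    | 3, _ => 3
  start := 0
  accept := {0, 2}

lemma trap (w : List Bool) : Mdfa.evalFrom 3 w = 3 := by
  induction w with
  | nil => rfl
  | cons a w ih => rw [DFA.evalFrom_cons]; exact ih

lemma ev_b (k : ℕ) : Mdfa.evalFrom 2 (List.replicate k true) = 2 := by
  induction k with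
  | zero => rfl
  | succ k ih => rw [List.replicate_succ, DFA.evalFrom_cons]; exact ih

lemma ev_a (k : ℕ) : Mdfa.evalFrom 0 (List.replicate k false) = 0 := by
  induction k with
  | zero => rfl
  | succ k ih => rw [List.replicate_succ, DFA.evalFrom_cons]; exact ih

lemma ev_un (k m : ℕ) (hk : 2 ≤ k) : Mdfa.evalFrom 0 (un k m) = 0 := by
  obtain ⟨k, rfl⟩ : ∃ r, k = r + 2 := ⟨k - 2, by omega⟩
  induction m with
  | zero => rfl
  | succ m ih =>
    have e1 : Mdfa.evalFrom 0 (List.replicate (k+2) true) = 2 := by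
      rw [List.replicate_succ, List.replicate_succ, DFA.evalFrom_cons, DFA.evalFrom_cons]
      exact ev_b k
    have e2 : Mdfa.evalFrom 2 (List.replicate (k+2) false) = 0 := by
      rw [List.replicate_succ, DFA.evalFrom_cons]
      exact ev_a (k+1)
    rw [un, DFA.evalFrom_of_append, DFA.evalFrom_of_append, e1, e2, ih]

lemma mem_of (w : List Bool) (h : Mdfa.evalFrom 0 w = 0) : w ∈ Mdfa.accepts := by
  rw [DFA.mem_accepts]
  change Mdfa.evalFrom 0 w ∈ ({0, 2} : Set (Fin 4))
  rw [h]; simp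

lemma not_mem_of (u r : List Bool) (h : Mdfa.evalFrom 0 u = 0) :
    u ++ true :: false :: r ∉ Mdfa.accepts := by
  rw [DFA.mem_accepts]
  change Mdfa.evalFrom 0 _ ∉ ({0, 2} : Set (Fin 4))
  rw [DFA.evalFrom_of_append, h, DFA.evalFrom_cons, DFA.evalFrom_cons]
  change Mdfa.evalFrom 3 r ∉ _
  rw [trap]; simp

/-- a trivial reversible system accepting everything -/
def triv : DPWK Bool where
  M := Unit
  Q1 := Unit
  Q2 := Unit
  fM := inferInstance
  fQ1 := inferInstance
  fQ2 := inferInstance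
  δ1 := fun _ _ _ => none
  δ2 := fun _ _ _ => none
  μ1 := fun _ _ => none
  μ2 := fun _ _ => none
  q01 := ()
  q02 := ()
  F1 := Set.univ
  F2 := Set.univ

lemma triv_mem : (Set.univ : Set (List Bool)) ∈ RevPWKLangs Bool := by
  refine ⟨triv, ⟨⟨fun _ _ _ => none, fun _ _ _ => none, fun _ _ => none, fun _ _ => none, ?_⟩⟩, ?_⟩
  · intro w c c'
    simp [BackStep, Step, triv]
  · rw [Set.eq_univ_iff_forall]
    intro w
    refine ⟨[initConf triv w], rfl, List.isChain_singleton _, initConf triv w, rfl, ?_, ?_⟩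
    · rintro ⟨c, d1, d2, h, -⟩
      simp [triv] at h
    · exact Or.inl trivial

end lang
end PWKaux

namespace PWKaux
open WK

section final

lemma HC.mono' {S A : Type} {F : Sys S A} {C D : ℕ} (h : HC F C) (hCD : C ≤ D) : HC F D :=
  fun y x s z δ hu => (h y x s z δ hu).trans hCD

lemma tests_lin {A : Type} (T : ℤ → A) (n M K : ℕ) (B G : ℤ) (h1 : G ≤ B + (K + 1)) (h2 : B ≤ G) :
    Tests T (fun γ => G + 2 * (K + 1) * ((M + 1) * γ)) n M K
      (fun γ τ => B + 2 * (K + 1) * ((M + 1) * γ + 1 + (τ : ℕ))) where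
  mono := by
    intro a b hab
    have : (a : ℤ) ≤ b := by exact_mod_cast hab
    simp only
    gcongr
  pos0 := by
    intro γ _ τ
    have : (0 : ℤ) ≤ (K + 1) * (τ : ℕ) := by positivity
    nlinarith
  pos1 := by
    intro γ _ τ
    have h3 : ((τ : ℕ) : ℤ) + 1 ≤ M := by exact_mod_cast τ.2
    have : (0 : ℤ) ≤ (K + 1) * (M - 1 - (τ : ℕ)) := mul_nonneg (by positivity) (by linarith)
    push_cast
    nlinarith
  sp := by
    intro γ _ τ τ' hne
    rcases lt_or_gt_of_ne hne with h | h
    · left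
      have h3 : ((τ : ℕ) : ℤ) + 1 ≤ (τ' : ℕ) := by exact_mod_cast h
      have : (0 : ℤ) ≤ (K + 1) * ((τ' : ℕ) - 1 - (τ : ℕ)) := mul_nonneg (by positivity) (by linarith)
      nlinarith
    · right
      have h3 : ((τ' : ℕ) : ℤ) + 1 ≤ (τ : ℕ) := by exact_mod_cast h
      have : (0 : ℤ) ≤ (K + 1) * ((τ : ℕ) - 1 - (τ' : ℕ)) := mul_nonneg (by positivity) (by linarith)
      nlinarith

lemma lt_of_pos {K : ℕ} {B a b : ℤ} (h : B + 2 * (K + 1) * a + (K + 1) ≤ B + 2 * (K + 1) * b) :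
    a < b := by
  by_contra hh
  push Not at hh
  have : (0 : ℤ) ≤ (K + 1) * (a - b) := mul_nonneg (by positivity) (by linarith)
  nlinarith

open Nat in
lemma mainA {A : DPWK Bool} [Fintype (A.Q1 × A.Q2)] (hA : Reversible A) {C L K M m p : ℕ}
    (hC : HC (FA A) C) (hC' : HC (mF (FA A)) C) (hp : p = 2 * (K + 1) * (7 * (M + 1)))
    (w : List Bool) (hw : w = un (K + 1) (7 * (M + 1)) ++ un L m) {fin : Cfg (A.Q1 × A.Q2)}
    (hr : Reach (FA A) (Tz w) (ini A w) fin) (hh : ∀ d, ¬ Stp (FA A) (Tz w) fin d)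
    (hnev : ∀ c, Reach (FA A) (Tz w) (ini A w) c → c.u ≤ p → ¬ c.l ≤ p)
    (hL : C * p + Fintype.card (A.Q1 × A.Q2) < L)
    (hK1 : Fintype.card (A.Q1 × A.Q2) ≤ K)
    (hK2 : (Fintype.card (A.Q1 × A.Q2))! * (Fintype.card (A.Q1 × A.Q2))! ∣ K)
    (hM : Fintype.card (A.Q1 × A.Q2) * Fintype.card (A.Q1 × A.Q2) < M) :
    ∃ (j : ℕ) (w' rest : List Bool), w'.length = w.length ∧
      w' = un (K + 1) j ++ true :: false :: rest ∧
      Reach (FA A) (Tz w') (ini A w) fin ∧ ∀ d, ¬ Stp (FA A) (Tz w') fin d := by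
  have hlen : (un (K + 1) (7 * (M + 1))).length = p := by rw [un_length, hp]
  have hsc : Scene (FA A) (Tz w) (ini A w) fin (fun z => z ≤ (p : ℤ)) :=
    ⟨FA_inj hA, hr, hh, fun a z b h1 h2 h3 h4 => by omega, hnev⟩
  have hpz : (p : ℤ) = 2 * (K + 1) * (7 * (M + 1)) := by rw [hp]; push_cast; ring
  obtain ⟨γ, hγ, τ, τ', hpos, hZ⟩ := caseA (b := Sum.inl true) (L := L) hsc hC hC' (by
      intro x hx hne
      have := giant (un (K + 1) (7 * (M + 1))) L m x (by rw [hlen]; exact hx) (by rw [← hw]; exact hne)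
      rw [hlen] at this
      exact this) (tests_lin (Tz w) 7 M K 1 1 (by linarith) le_rfl)
    (by simp [ini]) (by rw [hpz]; push_cast; linarith) (by
      have : p ≤ w.length := by rw [hw, List.length_append, hlen]; omega
      simp only [ini]; omega) (by
      have : (C : ℤ) * p + Fintype.card (A.Q1 × A.Q2) < L := by exact_mod_cast hL
      rw [hpz] at this
      push_cast
      ring_nf at this ⊢
      exact this) hK1 hK2 hM
  have hlt := lt_of_pos hpos
  have hlt' : (M + 1) * γ + 1 + (τ : ℕ) < (M + 1) * γ + 1 + (τ' : ℕ) := by exact_mod_cast hlt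
  have hlt2 : (M + 1) * γ + 1 + (τ' : ℕ) < 7 * (M + 1) := by
    have := τ'.2
    have : (M + 1) * γ ≤ (M + 1) * 6 := Nat.mul_le_mul_left _ (by omega)
    omega
  obtain ⟨w', rest, z1, z2, z3⟩ := ZWun [] (un L m) K _ _ _ hlt' hlt2
  simp only [List.nil_append] at z1 z2 z3
  rw [← hw] at z1 z2
  refine ⟨_, w', rest, z2, z3, hZ (Tz w') ?_⟩
  convert z1 using 1 <;> push_cast <;> simp

open Nat in
lemma mainB {A : DPWK Bool} [Fintype (A.Q1 × A.Q2)] (hA : Reversible A) {K M n p : ℕ}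
    (X : List Bool) (hp : X.length = p)
    (w : List Bool) (hw : w = X ++ un (K + 1) (n * (M + 1))) {fin : Cfg (A.Q1 × A.Q2)}
    (hr : Reach (FA A) (Tz w) (ini A w) fin) (hh : ∀ d, ¬ Stp (FA A) (Tz w) fin d)
    (hnev : ∀ c, Reach (FA A) (Tz w) (ini A w) c → p < c.u → ¬ p < c.l)
    (hn : 2 * (p + 1) + 2 < n)
    (hK1 : Fintype.card (A.Q1 × A.Q2) ≤ K)
    (hK2 : (Fintype.card (A.Q1 × A.Q2))! * (Fintype.card (A.Q1 × A.Q2))! ∣ K)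
    (hM : Fintype.card (A.Q1 × A.Q2) * Fintype.card (A.Q1 × A.Q2) < M) :
    ∃ (j : ℕ) (w' rest : List Bool), w'.length = w.length ∧
      w' = X ++ un (K + 1) j ++ true :: false :: rest ∧
      Reach (FA A) (Tz w') (ini A w) fin ∧ ∀ d, ¬ Stp (FA A) (Tz w') fin d := by
  have hsc0 : Scene (FA A) (Tz w) (ini A w) fin (fun z => (p : ℤ) < z) :=
    ⟨FA_inj hA, hr, hh, fun a z b h1 h2 h3 h4 => by omega, hnev⟩
  have hsc := hsc0.mirror
  have hPp : (fun z : ℤ => (p : ℤ) < -z) = (fun z : ℤ => z ≤ -((p : ℤ) + 1)) := by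
    funext z; apply propext; constructor <;> intro h <;> omega
  rw [hPp] at hsc
  have hwl : (w.length : ℤ) = p + 2 * (K + 1) * (n * (M + 1)) := by
    rw [hw, List.length_append, un_length, hp]; push_cast; ring
  obtain ⟨γ, hγ, τ, τ', hpos, hZ⟩ := caseB (b := Sum.inl true) (V := p + 1) (n := n) hsc
    (tests_lin (mT (Tz w)) n M K (-((p : ℤ) + (K + 1) + 2 * (K + 1) * (n * (M + 1))))
      (-((p : ℤ) + 2 * (K + 1) * (n * (M + 1)))) (by linarith) (by linarith))
    (by simp only [mc, ini]; rw [hwl]; push_cast; linarith) (by push_cast; linarith)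
    (by simp only [mc, ini]; omega) (by
      intro c hc
      have h1 := Reach.mirror' hc
      rw [show mc (mc (ini A w)) = ini A w by simp] at h1
      have h2 := reach_nonneg h1
      simp only [mc] at h2
      push_cast
      constructor <;> omega) hn hK1 hK2 hM
  have hlt := lt_of_pos hpos
  have hlt' : (M + 1) * γ + 1 + (τ : ℕ) < (M + 1) * γ + 1 + (τ' : ℕ) := by exact_mod_cast hlt
  have hlt2 : (M + 1) * γ + 1 + (τ' : ℕ) ≤ n * (M + 1) := by
    have := τ'.2
    have : (M + 1) * (γ + 1) ≤ (M + 1) * n := Nat.mul_le_mul_left _ (by omega)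
    rw [mul_comm n]
    rw [mul_add] at this
    omega
  obtain ⟨w', rest, z1, z2, z3⟩ := ZWun X [] K (n * (M + 1) - ((M + 1) * γ + 1 + (τ' : ℕ)))
    (n * (M + 1) - ((M + 1) * γ + 1 + (τ : ℕ))) (n * (M + 1)) (by omega) (by omega)
  simp only [List.append_nil] at z1 z2 z3
  rw [← hw] at z1 z2
  have z4 := z1.mirror
  obtain ⟨k1, k2⟩ := hZ (mT (Tz w')) (by
    convert z4 using 1
    · rw [hp, Nat.cast_sub (by omega)]; push_cast; ring
    · rw [hp, Nat.cast_sub (by omega)]; push_cast; ring)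
  refine ⟨_, w', rest, z2, z3, ?_, ?_⟩
  · have := Reach.mirror' k1
    simpa using this
  · intro d hd
    exact k2 _ hd.mirror

open Nat in
lemma final {A : DPWK Bool} (hA : Reversible A)
    (hmem : ∀ w, Accepts A w ↔ w ∈ Mdfa.accepts) : False := by
  letI := A.fQ1
  letI := A.fQ2
  obtain ⟨C1, hC1⟩ := exists_HC (FA A)
  obtain ⟨C2, hC2⟩ := exists_HC (mF (FA A))
  set C := max C1 C2 with hC
  have hCa : HC (FA A) C := hC1.mono' (le_max_left _ _)
  have hCb : HC (mF (FA A)) C := hC2.mono' (le_max_right _ _)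
  set N := Fintype.card (A.Q1 × A.Q2) with hN
  set P := N ! with hP
  have hP1 : 1 ≤ P := Nat.factorial_pos N
  have hNP : N ≤ P := Nat.self_le_factorial N
  have hNPP : N ≤ P * P := hNP.trans (Nat.le_mul_of_pos_left _ hP1)
  have hPP1 : 1 ≤ P * P := Nat.mul_pos hP1 hP1
  set K1 := P * P with hK1
  set M := N * N + 1 with hM
  set p := 2 * (K1 + 1) * (7 * (M + 1)) with hp
  set X := un (K1 + 1) (7 * (M + 1)) with hX
  have hXl : X.length = p := by rw [hX, un_length]
  obtain ⟨E, hE⟩ : ∃ E, E = C * p + N + 1 := ⟨_, rfl⟩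
  set K2 := K1 * E with hK2
  have hEK : E ≤ K2 := Nat.le_mul_of_pos_left _ hPP1
  have hK2' : K1 ≤ K2 := Nat.le_mul_of_pos_right _ (by omega)
  set n := 2 * (p + 1) + 3 with hn
  obtain ⟨w, hw⟩ : ∃ w, w = X ++ un (K2 + 1) (n * (M + 1)) := ⟨_, rfl⟩
  have hwR : w ∈ Mdfa.accepts := by
    apply mem_of
    rw [hw, DFA.evalFrom_of_append, hX, ev_un _ _ (by omega), ev_un _ _ (by omega)]
  obtain ⟨fin, hr, hh, hf⟩ := acc_iff.1 ((hmem w).2 hwR)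
  have conc : ∀ (u w' rest : List Bool), Mdfa.evalFrom 0 u = 0 → w'.length = w.length →
      w' = u ++ true :: false :: rest → Reach (FA A) (Tz w') (ini A w) fin →
      (∀ d, ¬ Stp (FA A) (Tz w') fin d) → False := by
    intro u w' rest hu hl hw' hr' hh'
    have hi : ini A w = ini A w' := by simp [ini, hl]
    rw [hi] at hr'
    have := (hmem w').1 (acc_iff.2 ⟨fin, hr', hh', hf⟩)
    rw [hw'] at this
    exact not_mem_of u rest hu this
  by_cases hnev : ∀ c, Reach (FA A) (Tz w) (ini A w) c → c.u ≤ p → ¬ c.l ≤ p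
  · obtain ⟨j, w', rest, h1, h2, h3, h4⟩ := mainA (K := K1) (M := M) (L := K2 + 1) (p := p) hA hCa hCb hp
      w hw hr hh hnev (by omega) hNPP dvd_rfl (Nat.lt_succ_self _)
    exact conc _ w' rest (ev_un _ _ (by omega)) h1 h2 h3 h4
  · push Not at hnev
    obtain ⟨c, hc, hcu, hcl⟩ := hnev
    obtain ⟨j, w', rest, h1, h2, h3, h4⟩ := mainB (K := K2) (M := M) (n := n) hA X hXl w hw hr hh (by
      intro d hd hdu hdl
      have := (Reach.ord_u hc hd (by omega)).mono
      omega) (by omega) (by omega) (Dvd.intro _ rfl) (Nat.lt_succ_self _)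
    refine conc _ w' rest ?_ h1 h2 h3 h4
    rw [DFA.evalFrom_of_append, hX, ev_un _ _ (by omega), ev_un _ _ (by omega)]

end final
end PWKaux

open WK in
/-- The family of languages accepted by reversible deterministic
two-party Watson-Crick systems is not closed under intersection with regular
languages. -/
theorem REV_PWK_not_closed_inter_regular :
    ∃ (L R : Set (List Bool)), L ∈ RevPWKLangs Bool ∧
      Language.IsRegular (R : Language Bool) ∧ (L ∩ R) ∉ RevPWKLangs Bool := by
  refine ⟨Set.univ, PWKaux.Mdfa.accepts, PWKaux.triv_mem, ⟨Fin 4, inferInstance, PWKaux.Mdfa, rfl⟩, ?_⟩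
  rintro ⟨A, hA, hl⟩
  refine PWKaux.final hA fun w => ?_
  constructor
  · intro hw
    have h : w ∈ lang A := hw
    rw [hl] at h
    exact h.2
  · intro hw
    have h : w ∈ lang A := by
      rw [hl]
      exact ⟨trivial, hw⟩
    exact h
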